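/- arXiv:2409.18514 — 6 statements merged into one kernel-verified Lean document; each statement's English description precedes it below -/
import Mathlib

section
/- Let 𝓔 : B(ℋ) → B(ℋ) be a quantum channel on a finite-dimensional Hilbert space ℋ. Zeno Hamiltonian suppression by 𝓔 works — i.e. for every Hermitian H ∈ B(ℋ), the Zeno Hamiltonian 𝓗_Z^𝓔 = Σ_{|λ_ℓ|=1} P_ℓ ∘ [H,·] ∘ P_ℓ vanishes identically — if and only if 𝓔 does not admit any decoherence-free subsystem. -/
open Matrix Kronecker
open scoped ComplexOrder
noncomputable section

abbrev MatC (n : ℕ) := Matrix (Fin n) (Fin n) ℂ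

/-- The Choi-Jamiołkowski matrix of a linear map on matrices. -/
def choi {n : ℕ} (E : MatC n →ₗ[ℂ] MatC n) : Matrix (Fin n × Fin n) (Fin n × Fin n) ℂ :=
  fun p q => E (Matrix.single p.2 q.2 1) p.1 q.1

/-- A quantum channel: a completely positive (equivalently, with positive semidefinite
Choi matrix) and trace-preserving linear map. -/
def IsQuantumChannel {n : ℕ} (E : MatC n →ₗ[ℂ] MatC n) : Prop :=
  (choi E).PosSemidef ∧ ∀ A : MatC n, (E A).trace = A.trace

/-- A channel is ergodic when its fixed-point space is one-dimensional. -/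
def IsErgodic {n : ℕ} (E : MatC n →ₗ[ℂ] MatC n) : Prop :=
  Module.finrank ℂ (Module.End.eigenspace E 1) = 1


/-- `P` is the spectral projection of `E` associated with the eigenvalue `μ`: the projection
onto the generalized eigenspace of `μ` along the sum of all other generalized eigenspaces. -/
def IsSpectralProjection {n : ℕ} (E P : MatC n →ₗ[ℂ] MatC n) (μ : ℂ) : Prop :=
  P ∘ₗ P = P ∧
  LinearMap.range P = Module.End.maxGenEigenspace E μ ∧
  LinearMap.ker P = ⨆ ν ∈ {ν : ℂ | ν ≠ μ}, Module.End.maxGenEigenspace E ν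

def recSpace {n : ℕ} (E : MatC n →ₗ[ℂ] MatC n) : Submodule ℂ (MatC n) :=
  ⨆ μ ∈ {μ : ℂ | ‖μ‖ = 1}, Module.End.eigenspace E μ

/-- The structure decomposition of the space of recurrences of a quantum channel
(Wolf, Theorems 6.14 and 6.16): `X(𝓔) = 0 ⊕ ⊕ₖ M_{d_k} ⊗ ρ_k`, on which `𝓔` acts by
unitary conjugations `U_k` together with a permutation `π` of sub-blocks of equal
dimension.  The `k`-th block `ℋ_{k,1} ⊗ ℋ_{k,2}` is embedded into `ℋ` by the isometry
`V_k`, with mutually orthogonal ranges.  A decoherence-free subsystem is a block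
with `d_k ≥ 2`. -/
structure PeripheralDecomposition {n : ℕ} (E : MatC n →ₗ[ℂ] MatC n) where
  K : ℕ
  d : Fin K → ℕ
  m : Fin K → ℕ
  hd : ∀ k, 0 < d k
  hm : ∀ k, 0 < m k
  V : (k : Fin K) → Matrix (Fin n) (Fin (d k) × Fin (m k)) ℂ
  ρ : (k : Fin K) → Matrix (Fin (m k)) (Fin (m k)) ℂ
  U : (k : Fin K) → Matrix (Fin (d k)) (Fin (d k)) ℂ
  perm : Equiv.Perm (Fin K)
  hperm : ∀ k, d (perm k) = d k
  hViso : ∀ k, (V k)ᴴ * V k = 1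
  hVorth : ∀ k j, k ≠ j → (V k)ᴴ * V j = 0
  hρpos : ∀ k, (ρ k).PosDef
  hρtr : ∀ k, (ρ k).trace = 1
  hU : ∀ k, U k ∈ Matrix.unitaryGroup (Fin (d k)) ℂ
  hX : ∀ A : MatC n, A ∈ recSpace E ↔
    ∃ x : (k : Fin K) → Matrix (Fin (d k)) (Fin (d k)) ℂ,
      A = ∑ k, V k * (x k ⊗ₖ ρ k) * (V k)ᴴ
  hact : ∀ x : (k : Fin K) → Matrix (Fin (d k)) (Fin (d k)) ℂ,
    E (∑ k, V k * (x k ⊗ₖ ρ k) * (V k)ᴴ)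
      = ∑ k, V k *
          ((U k * (Matrix.reindex (finCongr (hperm k)) (finCongr (hperm k)) (x (perm k))) * (U k)ᴴ)
            ⊗ₖ ρ k) * (V k)ᴴ

/-- The sub-block of the space of recurrences associated with the cycle of `π`
containing the block index `k`. -/
def cycleBlock {n : ℕ} {E : MatC n →ₗ[ℂ] MatC n} (D : PeripheralDecomposition E)
    (k : Fin D.K) : Submodule ℂ (MatC n) :=
  Submodule.span ℂ {A | ∃ j, D.perm.SameCycle k j ∧
    ∃ x : Matrix (Fin (D.d j)) (Fin (D.d j)) ℂ, A = D.V j * (x ⊗ₖ D.ρ j) * (D.V j)ᴴ}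


namespace ZenoAux

theorem psd_factor {ι : Type} [Fintype ι] [DecidableEq ι] (σ : Matrix ι ι ℂ) (hσ : σ.PosSemidef) :
    ∃ (m : ℕ) (V : Matrix ι (Fin m) ℂ) (lam : Fin m → ℝ), (∀ k, 0 < lam k) ∧ Vᴴ * V = 1 ∧
      σ = V * Matrix.diagonal (fun k => (lam k : ℂ)) * Vᴴ := by
  classical
  set hA := hσ.isHermitian with hAdef
  set J := {i // hA.eigenvalues i ≠ 0}
  let e : Fin (Fintype.card J) ≃ J := (Fintype.equivFin J).symm
  let U : Matrix ι ι ℂ := (hA.eigenvectorUnitary : Matrix ι ι ℂ)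
  have hU : Uᴴ * U = 1 := by
    have := (Matrix.mem_unitaryGroup_iff' (A := U)).1 hA.eigenvectorUnitary.2
    simpa [Matrix.star_eq_conjTranspose] using this
  refine ⟨Fintype.card J, U.submatrix id (fun k => (e k).1), fun k => hA.eigenvalues (e k).1,
    ?_, ?_, ?_⟩
  · intro k
    exact lt_of_le_of_ne (hσ.eigenvalues_nonneg _) (Ne.symm (e k).2)
  · ext a b
    have := congrFun (congrFun hU (e a).1) (e b).1
    simp only [Matrix.mul_apply, Matrix.conjTranspose_apply, Matrix.submatrix_apply, id,
      Matrix.one_apply] at this ⊢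
    rw [this]
    simp [Subtype.val_injective.eq_iff]
  · have h := hA.spectral_theorem
    rw [Unitary.conjStarAlgAut_apply] at h
    conv_lhs => rw [h]
    ext a b
    rw [Matrix.mul_apply, Matrix.mul_apply]
    simp only [Matrix.mul_diagonal, Matrix.conjTranspose_apply,
      Matrix.submatrix_apply, id, Matrix.star_apply, Function.comp]
    let g : ι → ℂ := fun i => U a i * (hA.eigenvalues i : ℂ) * star (U b i)
    change ∑ i, g i = ∑ k, g (e k).1
    rw [Equiv.sum_comp e (fun j : J => g j.1)]
    have h2 := Finset.sum_subtype (Finset.univ.filter (fun i => hA.eigenvalues i ≠ 0))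
      (p := fun i => hA.eigenvalues i ≠ 0) (F := inferInstance) (by simp) g
    refine Eq.trans ?_ h2
    rw [Finset.sum_filter_of_ne]
    intro x _ hx h0
    exact hx (by simp [g, h0])

theorem psd_sqrt {ι : Type} [Fintype ι] [DecidableEq ι] (σ : Matrix ι ι ℂ) (hσ : σ.PosSemidef) :
    ∃ (m : ℕ) (R : Matrix ι (Fin m) ℂ), σ = R * Rᴴ ∧ (Rᴴ * R).PosDef := by
  obtain ⟨m, V, lam, hl, hV, h⟩ := psd_factor σ hσ
  have hd : (Matrix.diagonal fun k => ((Real.sqrt (lam k) : ℝ) : ℂ)) *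
      (Matrix.diagonal fun k => ((Real.sqrt (lam k) : ℝ) : ℂ)) = Matrix.diagonal (fun k => (lam k : ℂ)) := by
    rw [Matrix.diagonal_mul_diagonal]
    congr 1; ext k
    rw [← Complex.ofReal_mul, Real.mul_self_sqrt (hl k).le]
  have hc : (Matrix.diagonal fun k => ((Real.sqrt (lam k) : ℝ) : ℂ))ᴴ =
      (Matrix.diagonal fun k => ((Real.sqrt (lam k) : ℝ) : ℂ)) := by
    rw [Matrix.diagonal_conjTranspose]; congr 1; ext k; simp
  refine ⟨m, V * Matrix.diagonal (fun k => ((Real.sqrt (lam k) : ℝ) : ℂ)), ?_, ?_⟩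
  · rw [Matrix.conjTranspose_mul, hc, h, ← hd]; simp only [Matrix.mul_assoc]
  · rw [Matrix.conjTranspose_mul, hc, Matrix.mul_assoc, ← Matrix.mul_assoc Vᴴ, hV, Matrix.one_mul, hd]
    exact Matrix.PosDef.diagonal (fun k => by exact_mod_cast hl k)

theorem kraus {n : ℕ} (E : MatC n →ₗ[ℂ] MatC n) (h : (choi E).PosSemidef) :
    ∃ (N : ℕ) (K : Fin N → MatC n), ∀ A, E A = ∑ i, K i * A * (K i)ᴴ := by
  obtain ⟨m, R, hR, -⟩ := psd_sqrt _ h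
  refine ⟨m, fun r => Matrix.of fun a b => R (a, b) r, fun A => ?_⟩
  have key : ∀ p q, E (Matrix.single p q 1) = ∑ i, (Matrix.of fun a b => R (a, b) i) *
      Matrix.single p q 1 * (Matrix.of fun a b => R (a, b) i)ᴴ := by
    intro p q
    ext a b
    have := congrFun (congrFun hR (a, p)) (b, q)
    simp only [choi] at this
    rw [this, Matrix.sum_apply]
    simp [Matrix.mul_apply, Matrix.single_apply, Finset.sum_ite_eq, ite_and]
  let G : MatC n →ₗ[ℂ] MatC n := ∑ i : Fin m, (LinearMap.mulRight ℂ (Matrix.of fun a b => R (a, b) i)ᴴ) ∘ₗ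
    (LinearMap.mulLeft ℂ (Matrix.of fun a b => R (a, b) i))
  have hG : ∀ A, G A = ∑ i, (Matrix.of fun a b => R (a, b) i) *
      A * (Matrix.of fun a b => R (a, b) i)ᴴ := by
    intro A; simp [G, LinearMap.sum_apply]
  rw [← hG]
  congr 1
  apply Matrix.ext_linearMap
  intro p q
  ext1
  simp only [LinearMap.comp_apply, Matrix.singleLinearMap]
  exact (key p q).trans (hG _).symm

/-! ### power bounded maps -/

def PB {W : Type} [AddCommGroup W] [Module ℂ W] (T : W →ₗ[ℂ] W) : Prop :=
  ∀ (φ : Module.Dual ℂ W) (A : W), ∃ C : ℝ, ∀ k : ℕ, ‖φ ((T ^ k) A)‖ ≤ C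

section
variable {W : Type} [AddCommGroup W] [Module ℂ W] {T : W →ₗ[ℂ] W}

theorem PB.jordan (hT : PB T) {μ : ℂ} (hμ : ‖μ‖ = 1) {v w : W} (hw : T w = μ • w)
    (hv : T v = μ • v + w) : w = 0 := by
  rw [← Module.forall_dual_apply_eq_zero_iff ℂ]
  intro φ
  obtain ⟨C, hC⟩ := hT φ v
  have hk : ∀ k : ℕ, μ • (T ^ k) v = μ ^ (k + 1) • v + (k * μ ^ k) • w := by
    intro k
    induction k with
    | zero => simp
    | succ k ih =>
      rw [pow_succ', Module.End.mul_apply, ← map_smul, ih, map_add, map_smul, map_smul, hv, hw]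
      push_cast
      module
  by_contra hne
  have hpos : 0 < ‖φ w‖ := norm_pos_iff.2 hne
  obtain ⟨k, hk'⟩ := exists_nat_gt ((C + ‖φ v‖) / ‖φ w‖)
  rw [div_lt_iff₀ hpos] at hk'
  have h1 := congrArg φ (hk k)
  simp only [map_smul, map_add, smul_eq_mul] at h1
  have h2 : (k * μ ^ k) * φ w = μ * φ ((T ^ k) v) - μ ^ (k+1) * φ v := by rw [h1]; ring
  have h3 := congrArg norm h2
  have h4 := norm_sub_le (μ * φ ((T ^ k) v)) (μ ^ (k+1) * φ v)
  rw [← h3] at h4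
  simp [hμ] at h4
  linarith [hC k]

theorem PB.ker_pow (hT : PB T) {μ : ℂ} (hμ : ‖μ‖ = 1) (k : ℕ) (v : W)
    (h : ((T - algebraMap ℂ (Module.End ℂ W) μ) ^ k) v = 0) : T v = μ • v ∨ k = 0 := by
  induction k with
  | zero => right; rfl
  | succ k ih =>
    left
    rcases Nat.eq_zero_or_pos k with rfl | hk
    · simpa [sub_eq_zero] using h
    · obtain ⟨l, rfl⟩ : ∃ l, k = l + 1 := ⟨k - 1, by omega⟩
      have : T v = μ • v ∨ l + 1 = 0 := by
        apply ih
        set f := T - algebraMap ℂ (Module.End ℂ W) μ with hf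
        have hfv : ∀ x, T x = μ • x + f x := by intro x; simp [hf]
        rw [pow_succ', Module.End.mul_apply]
        rw [pow_succ', pow_succ', Module.End.mul_apply, Module.End.mul_apply] at h
        refine hT.jordan hμ (v := (f ^ l) v) ?_ (hfv _)
        rw [hfv, h, add_zero]
      simpa using this

theorem PB.maxGen (hT : PB T) {μ : ℂ} (hμ : ‖μ‖ = 1) :
    Module.End.maxGenEigenspace T μ = Module.End.eigenspace T μ := by
  apply le_antisymm
  · intro v hv
    rw [Module.End.mem_maxGenEigenspace] at hv
    obtain ⟨k, hk⟩ := hv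
    rw [Module.End.mem_eigenspace_iff]
    rcases hT.ker_pow hμ k v hk with h | rfl
    · exact h
    · have : v = 0 := by simpa using hk
      simp [this]
  · exact (Module.End.genEigenspace T μ).mono le_top

theorem PB.decomp [FiniteDimensional ℂ W] (hT : PB T) {μ : ℂ} (hμ : ‖μ‖ = 1) (b : W) :
    ∃ b₀ c, T b₀ = μ • b₀ ∧ b = b₀ + (T c - μ • c) := by
  set f := T - algebraMap ℂ (Module.End ℂ W) μ with hf
  have hfv : ∀ x, f x = T x - μ • x := by intro x; simp [hf]
  have hd : Disjoint (LinearMap.ker f) (LinearMap.range f) := by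
    rw [Submodule.disjoint_def]
    rintro x hx ⟨c, rfl⟩
    rw [LinearMap.mem_ker, hfv, sub_eq_zero] at hx
    exact hT.jordan hμ (v := c) hx (by rw [hfv]; abel)
  have htop : LinearMap.ker f ⊔ LinearMap.range f = ⊤ := by
    apply Submodule.eq_top_of_disjoint _ _ _ hd
    rw [add_comm, LinearMap.finrank_range_add_finrank_ker]
  have hb : b ∈ LinearMap.ker f ⊔ LinearMap.range f := htop ▸ Submodule.mem_top
  obtain ⟨b₀, h0, r, ⟨c, rfl⟩, h⟩ := Submodule.mem_sup.1 hb
  rw [LinearMap.mem_ker, hfv, sub_eq_zero] at h0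
  exact ⟨b₀, c, h0, by rw [← h, hfv]⟩

theorem PB.pow (hT : PB T) (N : ℕ) : PB (T ^ N) := by
  intro φ A
  obtain ⟨C, hC⟩ := hT φ A
  exact ⟨C, fun k => by rw [← pow_mul]; exact hC _⟩

end

/-! ### positivity -/

theorem psd_eq {ι : Type} [Fintype ι] [DecidableEq ι] {B : Matrix ι ι ℂ} (hB : B.PosSemidef) :
    ∃ (m : ℕ) (C : Matrix (Fin m) ι ℂ), B = Cᴴ * C := by
  obtain ⟨m, R, h, -⟩ := psd_sqrt B hB
  exact ⟨m, Rᴴ, by simpa using h⟩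

theorem psd_entry_le {n : ℕ} {B : MatC n} (hB : B.PosSemidef) (i j : Fin n) :
    ‖B i j‖ ≤ B.trace.re := by
  obtain ⟨m, C, rfl⟩ := psd_eq hB
  have htr : (Cᴴ * C).trace.re = ∑ a, ∑ k, ‖C k a‖ ^ 2 := by
    simp only [Matrix.trace, Matrix.diag, Matrix.mul_apply, Matrix.conjTranspose_apply,
      Complex.re_sum]
    refine Finset.sum_congr rfl fun a _ => Finset.sum_congr rfl fun k _ => ?_
    rw [Complex.star_def, ← Complex.normSq_eq_conj_mul_self, Complex.ofReal_re, Complex.normSq_eq_norm_sq]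
  have hle : ∀ a, ∑ k, ‖C k a‖ ^ 2 ≤ ∑ a, ∑ k, ‖C k a‖ ^ 2 := fun a =>
    Finset.single_le_sum (f := fun a => ∑ k, ‖C k a‖ ^ 2)
      (fun a _ => Finset.sum_nonneg fun k _ => by positivity) (Finset.mem_univ a)
  rw [htr, Matrix.mul_apply]
  calc ‖∑ k, Cᴴ i k * C k j‖ ≤ ∑ k, ‖Cᴴ i k * C k j‖ := norm_sum_le _ _
    _ ≤ ∑ k, (‖C k i‖ ^ 2 + ‖C k j‖ ^ 2) / 2 := by
        refine Finset.sum_le_sum fun k _ => ?_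
        rw [norm_mul, Matrix.conjTranspose_apply, norm_star]
        nlinarith [sq_nonneg (‖C k i‖ - ‖C k j‖)]
    _ = ((∑ k, ‖C k i‖ ^ 2) + ∑ k, ‖C k j‖ ^ 2) / 2 := by
        rw [← Finset.sum_div, Finset.sum_add_distrib]
    _ ≤ _ := by linarith [hle i, hle j]

section
open scoped MatrixOrder Matrix.Norms.L2Operator

theorem psd_span (n : ℕ) : Submodule.span ℂ {A : MatC n | A.PosSemidef} = ⊤ := by
  have := CStarAlgebra.span_nonneg (A := CStarMatrix (Fin n) (Fin n) ℂ)
  have h2 := CStarAlgebra.span_nonneg (A := MatC n)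
  simpa only [Matrix.nonneg_iff_posSemidef] using h2

theorem psd_bound {n : ℕ} {B : MatC n} (hB : B.PosSemidef) :
    ∃ c : ℝ, 0 ≤ c ∧ ((c : ℂ) • (1 : MatC n) - B).PosSemidef := by
  have h : IsSelfAdjoint B := hB.isHermitian
  refine ⟨‖B‖, norm_nonneg _, ?_⟩
  have := IsSelfAdjoint.le_algebraMap_norm_self h
  rw [Matrix.le_iff] at this
  have h2 : (algebraMap ℝ (MatC n)) ‖B‖ = ((‖B‖ : ℝ) : ℂ) • (1 : MatC n) := by
    rw [Algebra.algebraMap_eq_smul_one]; rfl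
  rw [h2] at this
  exact this

end

theorem dual_entries {n : ℕ} (φ : Module.Dual ℂ (MatC n)) (A : MatC n) :
    φ A = ∑ i, ∑ j, A i j * φ (Matrix.single i j 1) := by
  conv_lhs => rw [Matrix.matrix_eq_sum_single A]
  simp only [map_sum]
  refine Finset.sum_congr rfl fun i _ => Finset.sum_congr rfl fun j _ => ?_
  rw [← smul_eq_mul, ← map_smul]
  simp

def PosMap {n : ℕ} (T : MatC n →ₗ[ℂ] MatC n) : Prop := ∀ A, A.PosSemidef → (T A).PosSemidef

theorem PosMap.pow {n : ℕ} {T : MatC n →ₗ[ℂ] MatC n} (hT : PosMap T) (k : ℕ) : PosMap (T ^ k) := by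
  induction k with
  | zero => intro A hA; simpa using hA
  | succ k ih =>
    intro A hA
    rw [pow_succ', Module.End.mul_apply]
    exact hT _ (ih _ hA)

theorem posMap_of_kraus {n N : ℕ} {E : MatC n →ₗ[ℂ] MatC n} {K : Fin N → MatC n}
    (hK : ∀ A, E A = ∑ i, K i * A * (K i)ᴴ) : PosMap E := by
  intro A hA
  rw [hK]
  exact Matrix.posSemidef_sum _ fun i _ => hA.mul_mul_conjTranspose_same _

theorem trace_pow {n : ℕ} {E : MatC n →ₗ[ℂ] MatC n} (h : ∀ A, (E A).trace = A.trace) (k : ℕ) (A : MatC n) :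
    ((E ^ k) A).trace = A.trace := by
  induction k with
  | zero => simp
  | succ k ih => rw [pow_succ', Module.End.mul_apply, h, ih]

theorem pb_of_channel {n : ℕ} {E : MatC n →ₗ[ℂ] MatC n} (hp : PosMap E)
    (h : ∀ A, (E A).trace = A.trace) : PB E := by
  intro φ A
  have hA : A ∈ Submodule.span ℂ {A : MatC n | A.PosSemidef} := by rw [psd_span]; trivial
  induction hA using Submodule.span_induction with
  | mem A hA =>
    refine ⟨∑ i, ∑ j, A.trace.re * ‖φ (Matrix.single i j 1)‖, fun k => ?_⟩
    rw [dual_entries]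
    refine (norm_sum_le _ _).trans (Finset.sum_le_sum fun i _ => ?_)
    refine (norm_sum_le _ _).trans (Finset.sum_le_sum fun j _ => ?_)
    rw [norm_mul]
    refine mul_le_mul_of_nonneg_right ?_ (norm_nonneg _)
    have := psd_entry_le (hp.pow k A hA) i j
    rwa [trace_pow h] at this
  | zero => exact ⟨0, by simp⟩
  | add A B _ _ hA hB =>
    obtain ⟨C, hC⟩ := hA
    obtain ⟨D, hD⟩ := hB
    refine ⟨C + D, fun k => ?_⟩
    rw [map_add, map_add]
    exact (norm_add_le _ _).trans (add_le_add (hC k) (hD k))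
  | smul a A _ hA =>
    obtain ⟨C, hC⟩ := hA
    refine ⟨‖a‖ * C, fun k => ?_⟩
    rw [map_smul, map_smul, norm_smul]
    exact mul_le_mul_of_nonneg_left (hC k) (norm_nonneg _)

open Filter Topology in
theorem psd_limit {n : ℕ} {T : MatC n →ₗ[ℂ] MatC n} (hT : PB T) {B B₀ c Z : MatC n}
    (hB : B = B₀ + (T c - c)) (h0 : T B₀ = B₀) (hpos : ∀ k, ((T ^ k) B + Z).PosSemidef) :
    (B₀ + Z).PosSemidef := by
  have hs : ∀ N : ℕ, ∑ k ∈ Finset.range N, ((T ^ k) B + Z) = (N : ℂ) • (B₀ + Z) + ((T ^ N) c - c) := by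
    intro N
    have hB0 : ∀ k, (T ^ k) B₀ = B₀ := by
      intro k
      induction k with
      | zero => simp
      | succ k ih => rw [pow_succ', Module.End.mul_apply, ih, h0]
    induction N with
    | zero => simp
    | succ N ih =>
      rw [Finset.sum_range_succ, ih, hB, map_add, map_sub, hB0, ← Module.End.mul_apply, ← pow_succ]
      push_cast
      module
  have hpsd : ∀ N : ℕ, (((N : ℂ) + 1)⁻¹ • ∑ k ∈ Finset.range (N+1), ((T ^ k) B + Z)).PosSemidef := by
    intro N
    refine (Matrix.posSemidef_sum _ fun k _ => hpos k).smul ?_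
    have : (0:ℝ) ≤ ((N:ℝ)+1)⁻¹ := by positivity
    have h2 := Complex.zero_le_real.2 this
    push_cast at h2
    exact h2
  have hlim : Tendsto (fun N : ℕ => (((N : ℂ) + 1)⁻¹ • ∑ k ∈ Finset.range (N+1), ((T ^ k) B + Z)))
      atTop (𝓝 (B₀ + Z)) := by
    refine tendsto_pi_nhds.2 fun i => tendsto_pi_nhds.2 fun j => ?_
    obtain ⟨C, hC⟩ := hT (Matrix.entryLinearMap ℂ ℂ i j) c
    have hh : ∀ N : ℕ, (((N : ℂ) + 1)⁻¹ • ∑ k ∈ Finset.range (N+1), ((T ^ k) B + Z)) i j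
        = (B₀ + Z) i j + ((N : ℂ) + 1)⁻¹ * (((T ^ (N+1)) c) i j - c i j) := by
      intro N
      rw [hs (N+1)]
      have : (N : ℂ) + 1 ≠ 0 := Nat.cast_add_one_ne_zero N
      simp only [Matrix.smul_apply, Matrix.add_apply, Matrix.sub_apply, smul_eq_mul]
      push_cast
      field_simp
    simp only [hh]
    have hz : Tendsto (fun N : ℕ => ((N : ℂ) + 1)⁻¹ * (((T ^ (N+1)) c) i j - c i j)) atTop (𝓝 0) := by
      apply squeeze_zero_norm (a := fun N : ℕ => (1 / ((N:ℝ) + 1)) * (C + ‖c i j‖))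
      · intro N
        rw [norm_mul]
        have h1 : ‖((N : ℂ) + 1)⁻¹‖ = 1 / ((N:ℝ) + 1) := by
          rw [norm_inv, one_div]
          congr 1
          have : ((N : ℂ) + 1) = ((N + 1 : ℝ) : ℂ) := by push_cast; rfl
          rw [this, Complex.norm_real, Real.norm_of_nonneg (by positivity)]
        rw [h1]
        refine mul_le_mul_of_nonneg_left ?_ (by positivity)
        have := hC (N+1)
        simp only [Matrix.entryLinearMap_apply] at this
        exact (norm_sub_le _ _).trans (add_le_add this le_rfl)
      · simpa using (tendsto_one_div_add_atTop_nhds_zero_nat (𝕜 := ℝ)).mul_const (C + ‖c i j‖)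
    simpa using (tendsto_const_nhds (x := (B₀ + Z) i j)).add hz
  refine Matrix.PosSemidef.of_dotProduct_mulVec_nonneg ?_ ?_
  · have h1 : Tendsto (fun N : ℕ => (((N : ℂ) + 1)⁻¹ • ∑ k ∈ Finset.range (N+1), ((T ^ k) B + Z))ᴴ)
      atTop (𝓝 (B₀ + Z)ᴴ) := (Continuous.tendsto (f := fun M : MatC n => Mᴴ) (continuous_id.matrix_conjTranspose) _).comp hlim
    have h2 : (fun N : ℕ => (((N : ℂ) + 1)⁻¹ • ∑ k ∈ Finset.range (N+1), ((T ^ k) B + Z))ᴴ) =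
        (fun N : ℕ => (((N : ℂ) + 1)⁻¹ • ∑ k ∈ Finset.range (N+1), ((T ^ k) B + Z))) := by
      funext N; exact (hpsd N).isHermitian
    rw [h2] at h1
    exact tendsto_nhds_unique h1 hlim
  · intro x
    have h1 : Tendsto (fun N : ℕ => star x ⬝ᵥ (((N : ℂ) + 1)⁻¹ • ∑ k ∈ Finset.range (N+1), ((T ^ k) B + Z)) *ᵥ x)
      atTop (𝓝 (star x ⬝ᵥ (B₀ + Z) *ᵥ x)) :=
      (Continuous.tendsto (f := fun M : MatC n => star x ⬝ᵥ M *ᵥ x) (by fun_prop) _).comp hlim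
    exact ge_of_tendsto' h1 fun N => (hpsd N).dotProduct_mulVec_nonneg x

/-! ### spectral projections -/

theorem sp_props {n : ℕ} {E P : MatC n →ₗ[ℂ] MatC n} {μ : ℂ} (hE : PB E) (hμ : ‖μ‖ = 1)
    (hP : IsSpectralProjection E P μ) :
    (∀ A, E (P A) = μ • P A) ∧ (∀ A, E A = μ • A → P A = A) ∧ (∀ C, P (E C - μ • C) = 0) ∧
    (∀ A ν, ν ≠ μ → E A = ν • A → P A = 0) := by
  obtain ⟨h1, h2, h3⟩ := hP
  have ha : ∀ A, E (P A) = μ • P A := by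
    intro A
    have : P A ∈ LinearMap.range P := ⟨A, rfl⟩
    rw [h2, hE.maxGen hμ, Module.End.mem_eigenspace_iff] at this
    exact this
  have hb : ∀ A, E A = μ • A → P A = A := by
    intro A hA
    have : A ∈ LinearMap.range P := by
      rw [h2, hE.maxGen hμ, Module.End.mem_eigenspace_iff]; exact hA
    obtain ⟨B, rfl⟩ := this
    exact LinearMap.congr_fun h1 B
  have hinv : ∀ C, P C = 0 → P (E C) = 0 := by
    intro C hC
    rw [← LinearMap.mem_ker, h3] at hC ⊢
    suffices h : (⨆ ν ∈ {ν : ℂ | ν ≠ μ}, Module.End.maxGenEigenspace E ν) ≤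
      (⨆ ν ∈ {ν : ℂ | ν ≠ μ}, Module.End.maxGenEigenspace E ν).comap E from h hC
    refine iSup₂_le fun ν hν x hx => ?_
    rw [Submodule.mem_comap]
    refine Submodule.mem_iSup_of_mem ν (Submodule.mem_iSup_of_mem hν ?_)
    exact Module.End.mapsTo_maxGenEigenspace_of_comm (Commute.refl E) ν hx
  refine ⟨ha, hb, ?_, ?_⟩
  · intro C
    have hd : P (C - P C) = 0 := by
      rw [map_sub, hb (P C) (ha C), sub_self]
    have he := hinv _ hd
    rw [map_sub, ha, map_sub, map_smul, hb (P C) (ha C)] at he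
    rw [map_sub, map_smul]; exact he
  · intro A ν hν hA
    rw [← LinearMap.mem_ker, h3]
    refine Submodule.mem_iSup_of_mem ν (Submodule.mem_iSup_of_mem hν ?_)
    refine (Module.End.genEigenspace E ν).mono le_top (?_ : A ∈ Module.End.eigenspace E ν)
    rw [Module.End.mem_eigenspace_iff]; exact hA

theorem sp_exists {n : ℕ} (E : MatC n →ₗ[ℂ] MatC n) (μ : ℂ) :
    ∃ P, IsSpectralProjection E P μ := by
  have hc : IsCompl (Module.End.maxGenEigenspace E μ)
      (⨆ ν ∈ {ν : ℂ | ν ≠ μ}, Module.End.maxGenEigenspace E ν) := by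
    constructor
    · exact (Module.End.independent_maxGenEigenspace E) μ
    · rw [codisjoint_iff, eq_top_iff, ← Module.End.iSup_maxGenEigenspace_eq_top E]
      refine iSup_le fun ν => ?_
      by_cases h : ν = μ
      · subst h; exact le_sup_left
      · exact le_trans (le_iSup₂_of_le (f := fun ν (_ : ν ∈ {ν : ℂ | ν ≠ μ}) => Module.End.maxGenEigenspace E ν) ν h le_rfl) le_sup_right
  refine ⟨Submodule.projection _ _ hc, ?_, Submodule.range_projection hc, ?_⟩
  · ext1 A
    exact Submodule.projection_apply_of_mem_left hc (Submodule.projection_apply_mem hc A)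
  · ext A
    rw [LinearMap.mem_ker, Submodule.projection_apply_eq_zero_iff]

/-! ### backward direction -/

theorem scalar_aux {b y : ℂ} (h : ∀ ε : ℝ, 0 ≤ (Complex.I * ε) * b + (ε : ℂ) ^ 2 * y) : b = 0 := by
  have hre : ∀ ε : ℝ, 0 ≤ - ε * b.im + ε ^ 2 * y.re := by
    intro ε
    have := (Complex.le_def.1 (h ε)).1
    simp [← Complex.ofReal_pow] at this
    linarith
  have him : ∀ ε : ℝ, 0 = ε * b.re + ε ^ 2 * y.im := by
    intro ε
    have := (Complex.le_def.1 (h ε)).2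
    simp [← Complex.ofReal_pow] at this
    linarith
  have h1 := him 1
  have h2 := him (-1)
  have h3 := hre 1
  have h4 := hre (-1)
  have hy : 0 ≤ y.re := by linarith
  have hb : b.re = 0 := by linarith
  have h5 := hre (b.im / (y.re + 1))
  have h6 : b.im = 0 := by
    have hp : 0 < y.re + 1 := by linarith
    have e : - (b.im / (y.re + 1)) * b.im + (b.im / (y.re + 1)) ^ 2 * y.re
        = - (b.im / (y.re + 1)) ^ 2 := by field_simp; ring
    rw [e] at h5
    have h7 : b.im / (y.re + 1) = 0 := by nlinarith [sq_nonneg (b.im / (y.re + 1))]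
    rcases div_eq_zero_iff.1 h7 with h | h
    · exact h
    · linarith
  exact Complex.ext hb h6

theorem ker_pow_le_rec {n : ℕ} (E : MatC n →ₗ[ℂ] MatC n) {N : ℕ} (hN : 0 < N) {A : MatC n}
    (hA : (E ^ N) A = A) : A ∈ recSpace E := by
  have hN0 : (N : ℂ) ≠ 0 := by exact_mod_cast hN.ne'
  obtain ⟨η, hη⟩ : ∃ η : ℂ, IsPrimitiveRoot η N := ⟨_, Complex.isPrimitiveRoot_exp N hN.ne'⟩
  have hηn : ‖η‖ = 1 := hη.norm'_eq_one hN.ne'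
  have hη0 : η ≠ 0 := hη.ne_zero hN.ne'
  let B : ℕ → MatC n := fun l => ∑ k ∈ Finset.range N, η ^ (l * k) • (E ^ k) A
  have hB : ∀ l, B l ∈ recSpace E := by
    intro l
    have h1 : η ^ l • E (B l) = B l := by
      have e1 : η ^ l • E (B l) = ∑ k ∈ Finset.range N, η ^ (l * (k + 1)) • (E ^ (k + 1)) A := by
        simp only [B, map_sum, map_smul, Finset.smul_sum, smul_smul]
        refine Finset.sum_congr rfl fun k _ => ?_
        rw [pow_succ' E, Module.End.mul_apply, ← pow_add]
        congr 2; ring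
      have e2 := Finset.sum_range_succ (fun k => η ^ (l * k) • (E ^ k) A) N
      have e3 := Finset.sum_range_succ' (fun k => η ^ (l * k) • (E ^ k) A) N
      rw [e1]
      rw [e2] at e3
      have e4 : η ^ (l * N) = 1 := by rw [mul_comm, pow_mul, hη.pow_eq_one, one_pow]
      simp only [e4, hA, mul_zero, pow_zero, one_smul, Module.End.one_apply] at e3
      exact (add_right_cancel e3).symm
    have h2 : E (B l) = (η ^ l)⁻¹ • B l := by
      conv_rhs => rw [← h1]
      rw [smul_smul, inv_mul_cancel₀ (pow_ne_zero _ hη0), one_smul]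
    refine Submodule.mem_iSup_of_mem ((η ^ l)⁻¹) (Submodule.mem_iSup_of_mem ?_ ?_)
    · simp [hηn]
    · rw [Module.End.mem_eigenspace_iff]; exact h2
  have hsum : ∑ l ∈ Finset.range N, B l = (N : ℂ) • A := by
    simp only [B]
    rw [Finset.sum_comm]
    simp only [← Finset.sum_smul]
    rw [Finset.sum_eq_single_of_mem 0 (Finset.mem_range.2 hN)]
    · simp
    · intro k hk hk0
      have : ∑ l ∈ Finset.range N, η ^ (l * k) = 0 := by
        have hg := mul_geom_sum (η ^ k) N
        have h0 : (η ^ k) ^ N - 1 = 0 := by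
          rw [← pow_mul, mul_comm, pow_mul, hη.pow_eq_one, one_pow, sub_self]
        rw [h0] at hg
        have hne : η ^ k - 1 ≠ 0 :=
          sub_ne_zero.2 (hη.pow_ne_one_of_pos_of_lt hk0 (Finset.mem_range.1 hk))
        have := (mul_eq_zero.1 hg).resolve_left hne
        rw [← this]
        refine Finset.sum_congr rfl fun l _ => ?_
        rw [← pow_mul, mul_comm]
      rw [this, zero_smul]
  have : A = (N : ℂ)⁻¹ • ∑ l ∈ Finset.range N, B l := by
    rw [hsum, smul_smul, inv_mul_cancel₀ hN0, one_smul]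
  rw [this]
  exact Submodule.smul_mem _ _ (Submodule.sum_mem _ fun l _ => hB l)

theorem backward_core {n K : ℕ} {E : MatC n →ₗ[ℂ] MatC n} (hp : PosMap E)
    (htr : ∀ A, (E A).trace = A.trace) (τ : Fin K → MatC n) (hτ : ∀ k, (τ k).PosSemidef)
    (hτ1 : ∀ k, (τ k).trace = 1)
    (ℓ : Fin K → MatC n →ₗ[ℂ] ℂ) (hℓ : ∀ j B, B.PosSemidef → 0 ≤ ℓ j B)
    (hℓτ : ∀ j k, ℓ j (τ k) = if j = k then 1 else 0)
    (perm : Equiv.Perm (Fin K))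
    (hX : ∀ A ∈ recSpace E, ∃ c : Fin K → ℂ, A = ∑ k, c k • τ k)
    (hact : ∀ c : Fin K → ℂ, E (∑ k, c k • τ k) = ∑ k, c (perm k) • τ k)
    {μ : ℂ} (hμ : ‖μ‖ = 1) {P : MatC n →ₗ[ℂ] MatC n} (hP : IsSpectralProjection E P μ)
    {H : MatC n} (hH : H.IsHermitian) (A : MatC n) (hA : E A = μ • A) :
    P (H * A - A * H) = 0 := by
  have hPB := pb_of_channel hp htr
  obtain ⟨-, -, hP3, -⟩ := sp_props hPB hμ hP
  by_cases hA0 : A = 0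
  · simp [hA0]
  set N := orderOf perm with hN
  have hNpos : 0 < N := orderOf_pos perm
  have hpow : ∀ (m : ℕ) (c : Fin K → ℂ), (E ^ m) (∑ k, c k • τ k) = ∑ k, c ((perm ^ m) k) • τ k := by
    intro m
    induction m with
    | zero => intro c; simp
    | succ m ih =>
      intro c
      rw [pow_succ, Module.End.mul_apply, hact, ih (fun k => c (perm k))]
      simp [pow_succ']
  have hfix : ∀ c : Fin K → ℂ, (E ^ N) (∑ k, c k • τ k) = ∑ k, c k • τ k := by
    intro c; rw [hpow, hN, pow_orderOf_eq_one]; simp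
  have hμpow : ∀ m : ℕ, (E ^ m) A = μ ^ m • A := by
    intro m
    induction m with
    | zero => simp
    | succ m ih => rw [pow_succ', Module.End.mul_apply, ih, map_smul, hA, smul_smul, pow_succ]
  have hArec : A ∈ recSpace E := by
    refine Submodule.mem_iSup_of_mem μ (Submodule.mem_iSup_of_mem hμ ?_)
    rw [Module.End.mem_eigenspace_iff]; exact hA
  obtain ⟨c, hc⟩ := hX A hArec
  have hμN : μ ^ N = 1 := by
    have h1 := hμpow N
    have h2 := hfix c
    rw [← hc] at h2
    rw [h2] at h1
    have : (μ ^ N - 1) • A = 0 := by rw [sub_smul, one_smul, ← h1, sub_self]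
    rcases smul_eq_zero.1 this with h | h
    · exact sub_eq_zero.1 h
    · exact absurd h hA0
  have hPE : ∀ (m : ℕ) C, P ((E ^ m) C) = μ ^ m • P C := by
    intro m
    induction m with
    | zero => intro C; simp
    | succ m ih =>
      intro C
      have := hP3 ((E ^ m) C)
      rw [map_sub, map_smul, sub_eq_zero] at this
      rw [pow_succ', Module.End.mul_apply, this, ih, smul_smul, pow_succ']
  have hPG : ∀ C, P ((E ^ N) C - (1 : ℂ) • C) = 0 := by
    intro C; rw [map_sub, hPE, hμN, map_smul, sub_self]
  have hG := hPB.pow N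
  have hτfix : ∀ k, (E ^ N) (τ k) = τ k := by
    intro k
    have := hfix (Pi.single k 1)
    simpa [Pi.single_apply, ite_smul] using this
  have key : ∀ k, P (H * τ k - τ k * H) = 0 := by
    intro k
    obtain ⟨Z0, C, hZ0, hZ⟩ := hG.decomp (μ := 1) (by simp) (H * τ k - τ k * H)
    obtain ⟨Y0, D, hY0, hY⟩ := hG.decomp (μ := 1) (by simp) (H * τ k * H)
    rw [one_smul] at hZ0 hY0
    obtain ⟨b, hb⟩ := hX Z0 (ker_pow_le_rec E hNpos hZ0)
    have hℓZ : ∀ j, ℓ j Z0 = b j := by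
      intro j; rw [hb]; simp [hℓτ]
    have hpsd : ∀ ε : ℝ, (τ k + (Complex.I * ε) • Z0 + ((ε : ℂ) ^ 2) • Y0 + 0).PosSemidef := by
      intro ε
      refine psd_limit hG (B := (1 + (Complex.I * ε) • H) * τ k * (1 + (Complex.I * ε) • H)ᴴ)
        (c := (Complex.I * ε) • C + ((ε : ℂ) ^ 2) • D) ?_ ?_ ?_
      · have e1 : (1 + (Complex.I * ε) • H)ᴴ = 1 - (Complex.I * ε) • H := by
          rw [Matrix.conjTranspose_add, Matrix.conjTranspose_smul, hH.eq]
          simp [sub_eq_add_neg]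
        have hi : (Complex.I * (ε:ℂ)) * (Complex.I * ε) = - (ε : ℂ) ^ 2 := by
          linear_combination (ε : ℂ)^2 * Complex.I_mul_I
        have e2 : (1 + (Complex.I * ε) • H) * τ k * (1 - (Complex.I * ε) • H)
            = τ k + (Complex.I * ε) • (H * τ k - τ k * H) + ((ε : ℂ) ^ 2) • (H * τ k * H) := by
          simp only [add_mul, mul_sub, one_mul, mul_one, Matrix.smul_mul, Matrix.mul_smul, smul_smul, hi]
          module
        rw [e1, e2, hZ, hY]
        simp only [map_add, map_smul, one_smul]
        module
      · simp only [map_add, map_smul, hZ0, hY0, hτfix]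
      · intro m
        rw [add_zero]
        exact (hp.pow N).pow m _ ((hτ k).mul_mul_conjTranspose_same _)
    have hbj : ∀ j, j ≠ k → b j = 0 := by
      intro j hj
      refine scalar_aux (y := ℓ j Y0) fun ε => ?_
      have := hℓ j _ (hpsd ε)
      simpa [hℓτ, hj, hℓZ] using this
    have htrZ : Z0.trace = 0 := by
      have h1 := congrArg Matrix.trace hZ
      rw [one_smul, Matrix.trace_add, Matrix.trace_sub, Matrix.trace_sub, trace_pow htr, sub_self, add_zero,
        Matrix.trace_mul_comm, sub_self] at h1
      exact h1.symm
    have hZ00 : Z0 = 0 := by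
      have h1 : Z0 = b k • τ k := by
        rw [hb]
        exact Finset.sum_eq_single_of_mem k (Finset.mem_univ _) fun j _ hj => by rw [hbj j hj, zero_smul]
      rw [h1, Matrix.trace_smul, hτ1, smul_eq_mul, mul_one] at htrZ
      rw [h1, htrZ, zero_smul]
    rw [hZ, hZ00, zero_add]
    exact hPG C
  have : H * A - A * H = ∑ k, c k • (H * τ k - τ k * H) := by
    rw [hc, Finset.mul_sum, Finset.sum_mul, ← Finset.sum_sub_distrib]
    refine Finset.sum_congr rfl fun k _ => ?_
    rw [Matrix.mul_smul, Matrix.smul_mul, smul_sub]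
  rw [this, map_sum]
  exact Finset.sum_eq_zero fun k _ => by rw [map_smul, key, smul_zero]

theorem backward {n : ℕ} (E : MatC n →ₗ[ℂ] MatC n)
    (hp : PosMap E) (htr : ∀ A, (E A).trace = A.trace) (D : PeripheralDecomposition E)
    (hD : ∀ k, D.d k = 1) {μ : ℂ} (hμ : ‖μ‖ = 1) {P : MatC n →ₗ[ℂ] MatC n}
    (hP : IsSpectralProjection E P μ)
    {H : MatC n} (hH : H.IsHermitian) (A : MatC n) (hA : E A = μ • A) :
    P (H * A - A * H) = 0 := by
  have hsub : ∀ k, Subsingleton (Fin (D.d k)) := fun k => by rw [hD k]; infer_instance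
  have hsc : ∀ (k) (x : Matrix (Fin (D.d k)) (Fin (D.d k)) ℂ), ∃ c : ℂ, x = c • 1 := by
    intro k x
    have := hsub k
    refine ⟨x ⟨0, D.hd k⟩ ⟨0, D.hd k⟩, ?_⟩
    ext i j
    rw [Subsingleton.elim i ⟨0, D.hd k⟩, Subsingleton.elim j ⟨0, D.hd k⟩]
    simp
  let τ : Fin D.K → MatC n := fun k => D.V k * ((1 : Matrix (Fin (D.d k)) (Fin (D.d k)) ℂ) ⊗ₖ D.ρ k) * (D.V k)ᴴ
  have hcτ : ∀ c : Fin D.K → ℂ, ∑ k, D.V k * ((c k • (1 : Matrix (Fin (D.d k)) (Fin (D.d k)) ℂ)) ⊗ₖ D.ρ k) * (D.V k)ᴴ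
      = ∑ k, c k • τ k := by
    intro c
    refine Finset.sum_congr rfl fun k _ => ?_
    simp only [τ, Matrix.smul_kronecker, Matrix.mul_smul, Matrix.smul_mul]
  let ℓ : Fin D.K → MatC n →ₗ[ℂ] ℂ := fun j =>
    { toFun := fun B => ((D.V j)ᴴ * B * D.V j).trace
      map_add' := by intro x y; simp [Matrix.mul_add, Matrix.add_mul]
      map_smul' := by intro x y; simp }
  have hℓ : ∀ j B, ℓ j B = ((D.V j)ᴴ * B * D.V j).trace := fun j B => rfl
  have htr1 : ∀ k, ((1 : Matrix (Fin (D.d k)) (Fin (D.d k)) ℂ) ⊗ₖ D.ρ k).trace = 1 := by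
    intro k
    rw [Matrix.trace_kronecker, D.hρtr, Matrix.trace_one]; simp [hD k]
  have hVV : ∀ j k, ((D.V j)ᴴ * τ k * D.V j).trace = if j = k then 1 else 0 := by
    intro j k
    have e : (D.V j)ᴴ * τ k * D.V j = ((D.V j)ᴴ * D.V k) * ((1 : Matrix (Fin (D.d k)) (Fin (D.d k)) ℂ) ⊗ₖ D.ρ k) * ((D.V k)ᴴ * D.V j) := by
      simp only [τ, Matrix.mul_assoc]
    split_ifs with h
    · subst h; rw [e, D.hViso, Matrix.one_mul, Matrix.mul_one, htr1]
    · rw [e, D.hVorth j k h]; simp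
  refine backward_core hp htr τ ?_ ?_ ℓ ?_ ?_ D.perm ?_ ?_ hμ hP hH A hA
  · intro k
    exact (Matrix.PosSemidef.kronecker Matrix.PosSemidef.one (D.hρpos k).posSemidef).mul_mul_conjTranspose_same _
  · intro k
    simp only [τ]
    rw [Matrix.trace_mul_comm, ← Matrix.mul_assoc, D.hViso, Matrix.one_mul, htr1]
  · intro j B hB
    rw [hℓ]
    exact (hB.conjTranspose_mul_mul_same _).trace_nonneg
  · intro j k; rw [hℓ, hVV]
  · intro A hA
    obtain ⟨x, hx⟩ := (D.hX A).1 hA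
    choose c hc using fun k => hsc k (x k)
    refine ⟨c, ?_⟩
    rw [← hcτ, hx]
    exact Finset.sum_congr rfl fun k _ => by rw [hc k]
  · intro c
    rw [← hcτ, D.hact, ← hcτ]
    refine Finset.sum_congr rfl fun k _ => ?_
    congr 3
    have hu := Matrix.mem_unitaryGroup_iff.1 (D.hU k)
    rw [Matrix.star_eq_conjTranspose] at hu
    have : (Matrix.reindex (finCongr (D.hperm k)) (finCongr (D.hperm k)))
        (c (D.perm k) • (1 : Matrix (Fin (D.d (D.perm k))) (Fin (D.d (D.perm k))) ℂ)) = c (D.perm k) • 1 := by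
      ext i j
      simp [Matrix.one_apply]
    rw [this, Matrix.mul_smul, Matrix.smul_mul, Matrix.mul_one, hu]

/-! ### forward direction: compression to the support -/

theorem psd_ann {ι κ : Type} [Fintype ι] [DecidableEq ι] [Fintype κ] [DecidableEq κ] {B : Matrix ι ι ℂ} (hB : B.PosSemidef) {X : Matrix κ ι ℂ}
    (h : X * B * Xᴴ = 0) : X * B = 0 := by
  obtain ⟨m, C, rfl⟩ := psd_eq hB
  have : (X * Cᴴ) * (X * Cᴴ)ᴴ = 0 := by
    rw [← h, Matrix.conjTranspose_mul, Matrix.conjTranspose_conjTranspose]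
    simp only [Matrix.mul_assoc]
  have := Matrix.self_mul_conjTranspose_eq_zero.1 this
  rw [← Matrix.mul_assoc, this, Matrix.zero_mul]

open scoped MatrixOrder in
theorem psd_sum_zero {ι κ : Type} [Fintype ι] [DecidableEq ι] [Fintype κ] {B : κ → Matrix ι ι ℂ}
    (hB : ∀ k, (B k).PosSemidef) (h : ∑ k, B k = 0) (k : κ) : B k = 0 := by
  have := (Finset.sum_eq_zero_iff_of_nonneg (s := Finset.univ) (f := B)
    (fun k _ => Matrix.nonneg_iff_posSemidef.2 (hB k))).1 h
  exact this k (Finset.mem_univ _)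

theorem sum_sq_zero {ι κ : Type} {r : ℕ} [Fintype ι] [DecidableEq ι] [Fintype κ] {X : κ → Matrix ι (Fin r) ℂ}
    (h : ∑ k, X k * (X k)ᴴ = 0) (k : κ) : X k = 0 :=
  Matrix.self_mul_conjTranspose_eq_zero.1
    (psd_sum_zero (fun k => Matrix.posSemidef_self_mul_conjTranspose (X k)) h k)

theorem psd_add_zero {ι : Type} [Fintype ι] [DecidableEq ι] {A B : Matrix ι ι ℂ}
    (hA : A.PosSemidef) (hB : B.PosSemidef) (h : A + B = 0) : A = 0 := by
  have := psd_sum_zero (B := ![A, B]) (by intro k; fin_cases k <;> simpa) (by simpa using h) 0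
  simpa using this

theorem pow_eig {W : Type} [AddCommGroup W] [Module ℂ W] {T : W →ₗ[ℂ] W} {μ : ℂ} {A : W} (hA : T A = μ • A) (m : ℕ) :
    (T ^ m) A = μ ^ m • A := by
  induction m with
  | zero => simp
  | succ m ih => rw [pow_succ', Module.End.mul_apply, ih, map_smul, hA, smul_smul, pow_succ]

theorem dom {n N : ℕ} {E : MatC n →ₗ[ℂ] MatC n} {K : Fin N → MatC n}
    (hK : ∀ A, E A = ∑ i, K i * A * (K i)ᴴ) (hPB : PB E) {τ c : MatC n} (hτ : E τ = τ)
    (h1 : 1 = τ + (E c - c)) {μ : ℂ} (hμ : ‖μ‖ = 1) {A : MatC n} (hA : E A = μ • A) :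
    ∃ s : ℂ, (s • τ - (A + Aᴴ)).PosSemidef := by
  have hp : PosMap E := posMap_of_kraus hK
  have hstar : E Aᴴ = star μ • Aᴴ := by
    have : E Aᴴ = (E A)ᴴ := by
      rw [hK, hK, Matrix.conjTranspose_sum]
      refine Finset.sum_congr rfl fun i _ => ?_
      simp [Matrix.mul_assoc]
    rw [this, hA, Matrix.conjTranspose_smul]
  obtain ⟨d, -, hd⟩ := psd_bound (Matrix.posSemidef_self_mul_conjTranspose A)
  refine ⟨1 + d, ?_⟩
  have hmm : star μ * μ = 1 := by
    have := Complex.conj_mul' μ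
    rw [hμ] at this; simpa using this
  have := psd_limit hPB (B := ((1 : ℂ) + d) • (1 : MatC n)) (B₀ := ((1 : ℂ) + d) • τ)
    (c := ((1 : ℂ) + d) • c) (Z := - (A + Aᴴ)) (by conv_lhs => rw [h1]
                                                   rw [map_smul]; module) (by rw [map_smul, hτ]) ?_
  · rwa [← sub_eq_add_neg] at this
  intro k
  set z := star μ ^ k with hz
  have hzz : z * star z = 1 := by
    rw [hz, star_pow, star_star, ← mul_pow, hmm, one_pow]
  have hps : (((1 : ℂ) + d) • (1 : MatC n) - (z • A + star z • Aᴴ)).PosSemidef := by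
    have h2 := (Matrix.posSemidef_self_mul_conjTranspose ((1 : MatC n) - z • A)).add hd
    convert h2 using 1
    rw [Matrix.conjTranspose_sub, Matrix.conjTranspose_smul, Matrix.conjTranspose_one]
    simp only [sub_mul, mul_sub, one_mul, mul_one, Matrix.smul_mul, Matrix.mul_smul, smul_smul]
    rw [mul_comm (star z) z, hzz]
    module
  have h3 := hp.pow k _ hps
  rw [map_sub, map_add, map_smul (E ^ k) z, map_smul (E ^ k) (star z), pow_eig hA, pow_eig hstar, smul_smul, smul_smul, hz, ← mul_pow, hmm, star_pow, star_star,
    ← mul_pow, mul_comm μ, hmm, one_pow, one_smul, one_smul] at h3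
  rwa [← sub_eq_add_neg]

theorem compress {n N : ℕ} {E : MatC n →ₗ[ℂ] MatC n} {K : Fin N → MatC n}
    (hK : ∀ A, E A = ∑ i, K i * A * (K i)ᴴ) (hPB : PB E) :
    ∃ (r : ℕ) (R : Matrix (Fin n) (Fin r) ℂ) (B : Fin N → MatC r),
      (Rᴴ * R).PosDef ∧ (∀ a : MatC r, E (R * a * Rᴴ) = R * (∑ i, B i * a * (B i)ᴴ) * Rᴴ) ∧
      E (R * Rᴴ) = R * Rᴴ ∧
      ∀ (A : MatC n) (μ : ℂ), ‖μ‖ = 1 → E A = μ • A → ∃ y : MatC r, A = R * y * Rᴴ := by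
  have hp : PosMap E := posMap_of_kraus hK
  obtain ⟨τ, c, hτ, h1⟩ := hPB.decomp (μ := 1) (by simp) (1 : MatC n)
  rw [one_smul] at hτ h1
  have hτp : τ.PosSemidef := by
    have := psd_limit hPB (Z := 0) h1 hτ (fun k => by
      rw [add_zero]; exact hp.pow k _ Matrix.PosSemidef.one)
    rwa [add_zero] at this
  obtain ⟨r, R, hR, ht⟩ := psd_sqrt τ hτp
  set t := Rᴴ * R with htdef
  set L := t⁻¹ * Rᴴ with hL
  have htu : IsUnit t.det := (Matrix.isUnit_iff_isUnit_det t).1 ht.isUnit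
  have hLR : L * R = 1 := by rw [hL, Matrix.mul_assoc, ← htdef, Matrix.nonsing_inv_mul _ htu]
  set J := 1 - R * L with hJ
  have hJR : J * R = 0 := by
    rw [hJ, Matrix.sub_mul, Matrix.mul_assoc, hLR]; simp
  have hJτ : J * τ = 0 := by rw [hR, ← Matrix.mul_assoc, hJR, Matrix.zero_mul]
  have hherm : ∀ (A : MatC n) (μ : ℂ), ‖μ‖ = 1 → E A = μ • A → J * (A + Aᴴ) = 0 := by
    intro A μ hμ hA
    obtain ⟨s, hs⟩ := dom hK hPB hτ h1 hμ hA
    obtain ⟨s', hs'⟩ := dom hK hPB hτ h1 hμ (A := -A) (by rw [map_neg, hA, smul_neg])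
    have e1 := psd_add_zero (hs.mul_mul_conjTranspose_same J) (hs'.mul_mul_conjTranspose_same J) (by
      rw [← Matrix.add_mul, ← Matrix.mul_add]
      have : (s • τ - (A + Aᴴ) + (s' • τ - (-A + (-A)ᴴ))) = (s + s') • τ := by
        rw [Matrix.conjTranspose_neg]; module
      rw [this, Matrix.mul_smul, hJτ]; simp)
    have e2 := psd_ann hs e1
    rw [Matrix.mul_sub, Matrix.mul_smul, hJτ, smul_zero, zero_sub, neg_eq_zero] at e2
    exact e2
  have hKR : ∀ i, R * (L * K i * R) = K i * R := by
    intro i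
    have h2 : ∑ i, (J * (K i * R)) * (J * (K i * R))ᴴ = 0 := by
      have h3 := hK τ
      rw [hτ] at h3
      have h4 : J * τ * Jᴴ = 0 := by rw [hJτ, Matrix.zero_mul]
      rw [h3, Finset.mul_sum, Finset.sum_mul] at h4
      rw [← h4]
      refine Finset.sum_congr rfl fun i _ => ?_
      rw [hR]
      simp only [Matrix.conjTranspose_mul, Matrix.mul_assoc]
    have h5 := sum_sq_zero h2 i
    rw [hJ, Matrix.sub_mul, sub_eq_zero, Matrix.one_mul] at h5
    rw [h5]
    simp only [Matrix.mul_assoc]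
  refine ⟨r, R, fun i => L * K i * R, ht, ?_, by rw [← hR, hτ], ?_⟩
  · intro a
    rw [hK, Matrix.mul_sum, Matrix.sum_mul]
    refine Finset.sum_congr rfl fun i _ => ?_
    have e : R * (L * K i * R * a * (L * K i * R)ᴴ) * Rᴴ = (R * (L * K i * R)) * a * (R * (L * K i * R))ᴴ := by
      rw [Matrix.conjTranspose_mul R]
      simp only [Matrix.mul_assoc]
    rw [e, hKR, Matrix.conjTranspose_mul]
    simp only [Matrix.mul_assoc]
  · intro A μ hμ hA
    have e1 := hherm A μ hμ hA
    have e2 := hherm (Complex.I • A) μ hμ (by rw [map_smul, hA, smul_comm])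
    have e3 : J * A = 0 := by
      have : A = (2⁻¹ : ℂ) • ((A + Aᴴ) - Complex.I • (Complex.I • A + (Complex.I • A)ᴴ)) := by
        rw [Matrix.conjTranspose_smul]
        simp only [smul_add, smul_smul, Complex.star_def, Complex.conj_I, Complex.I_mul_I, mul_neg, neg_neg]
        module
      rw [this, Matrix.mul_smul, Matrix.mul_sub, Matrix.mul_smul, e1, e2]; simp
    have e4 : J * Aᴴ = 0 := by rwa [Matrix.mul_add, e3, zero_add] at e1
    rw [hJ, Matrix.sub_mul, Matrix.one_mul, sub_eq_zero] at e3 e4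
    have e5 : A = A * (R * L)ᴴ := by
      have := congrArg Matrix.conjTranspose e4
      rwa [Matrix.conjTranspose_mul, Matrix.conjTranspose_conjTranspose] at this
    refine ⟨L * A * Lᴴ, ?_⟩
    have e6 : R * (L * A * Lᴴ) * Rᴴ = (R * L * A) * (R * L)ᴴ := by
      rw [Matrix.conjTranspose_mul R L]; simp only [Matrix.mul_assoc]
    rw [e6, ← e3, ← e5]

structure Core {r N : ℕ} (B : Fin N → MatC r) (t : MatC r) (F : MatC r →ₗ[ℂ] MatC r) : Prop where
  hF : ∀ a, F a = ∑ i, B i * a * (B i)ᴴ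
  h1 : F 1 = 1
  ht : t.PosDef
  htr : ∀ a, (t * F a).trace = (t * a).trace
  hPB : PB F
  hZ : ∀ (μ : ℂ) (y : MatC r), ‖μ‖ = 1 → F y = μ • y → ∀ K : MatC r, ∃ c : MatC r,
    K * y - y * (t * K * t⁻¹) = F c - μ • c

theorem hyp_all {n : ℕ} {E : MatC n →ₗ[ℂ] MatC n} (hPB : PB E)
    (hyp : ∀ S : Finset ℂ, (∀ μ : ℂ, μ ∈ S ↔ (Module.End.HasEigenvalue E μ ∧ ‖μ‖ = 1)) →
      ∀ P : ℂ → (MatC n →ₗ[ℂ] MatC n), (∀ μ ∈ S, IsSpectralProjection E (P μ) μ) →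
      ∀ H : MatC n, H.IsHermitian →
      ∀ A : MatC n, ∑ μ ∈ S, P μ (H * P μ A - P μ A * H) = 0)
    {μ : ℂ} (hμ : ‖μ‖ = 1) {P : MatC n →ₗ[ℂ] MatC n} (hP : IsSpectralProjection E P μ)
    {A : MatC n} (hA : E A = μ • A) (H : MatC n) : P (H * A - A * H) = 0 := by
  classical
  by_cases hA0 : A = 0
  · simp [hA0]
  have hfin : {ν : ℂ | Module.End.HasEigenvalue E ν ∧ ‖ν‖ = 1}.Finite :=
    (Module.End.finite_hasEigenvalue E).subset fun ν h => h.1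
  have hS : ∀ ν : ℂ, ν ∈ hfin.toFinset ↔ (Module.End.HasEigenvalue E ν ∧ ‖ν‖ = 1) := by
    intro ν; simp
  choose Q hQ using sp_exists E
  have hμS : μ ∈ hfin.toFinset := by
    rw [hS]
    refine ⟨?_, hμ⟩
    exact Module.End.hasEigenvalue_of_hasEigenvector ⟨Module.End.mem_eigenspace_iff.2 hA, hA0⟩
  have hsp : ∀ ν ∈ hfin.toFinset, IsSpectralProjection E (Function.update Q μ P ν) ν := by
    intro ν _
    by_cases h : ν = μ
    · subst h; simpa using hP
    · rw [Function.update_of_ne h]; exact hQ ν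
  have hherm : ∀ H : MatC n, H.IsHermitian → P (H * A - A * H) = 0 := by
    intro H hH
    have h := hyp _ hS _ hsp H hH A
    rw [Finset.sum_eq_single_of_mem μ hμS] at h
    · simp only [Function.update_self] at h
      rwa [(sp_props hPB hμ hP).2.1 A hA] at h
    · intro ν hν hne
      rw [(sp_props hPB ((hS ν).1 hν).2 (hsp ν hν)).2.2.2 A μ hne.symm hA]
      simp
  have e : H = (2⁻¹ : ℂ) • (H + Hᴴ) + (2⁻¹ * Complex.I) • (-Complex.I • (H - Hᴴ)) := by
    rw [smul_smul]
    have : 2⁻¹ * Complex.I * -Complex.I = 2⁻¹ := by linear_combination -2⁻¹ * Complex.I_mul_I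
    rw [this]; module
  have h1 := hherm (H + Hᴴ) (by rw [Matrix.IsHermitian]; simp [add_comm])
  have h2 := hherm (-Complex.I • (H - Hᴴ)) (by
    rw [Matrix.IsHermitian, Matrix.conjTranspose_smul]; simp [smul_sub]; abel)
  have e2 : H * A - A * H = (2⁻¹ : ℂ) • ((H + Hᴴ) * A - A * (H + Hᴴ))
      + (2⁻¹ * Complex.I) • ((-Complex.I • (H - Hᴴ)) * A - A * (-Complex.I • (H - Hᴴ))) := by
    conv_lhs => rw [e]
    simp only [add_mul, mul_add, Matrix.smul_mul, Matrix.mul_smul]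
    module
  rw [e2, map_add, map_smul, map_smul, h1, h2]; simp

theorem core_exists {n : ℕ} {E : MatC n →ₗ[ℂ] MatC n} (hE : IsQuantumChannel E)
    (hyp : ∀ S : Finset ℂ, (∀ μ : ℂ, μ ∈ S ↔ (Module.End.HasEigenvalue E μ ∧ ‖μ‖ = 1)) →
      ∀ P : ℂ → (MatC n →ₗ[ℂ] MatC n), (∀ μ ∈ S, IsSpectralProjection E (P μ) μ) →
      ∀ H : MatC n, H.IsHermitian →
      ∀ A : MatC n, ∑ μ ∈ S, P μ (H * P μ A - P μ A * H) = 0) :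
    ∃ (r N : ℕ) (R : Matrix (Fin n) (Fin r) ℂ) (B : Fin N → MatC r) (F : MatC r →ₗ[ℂ] MatC r),
      Core B (Rᴴ * R) F ∧ (∀ a, E (R * a * Rᴴ) = R * F a * Rᴴ) ∧
      (∀ (A : MatC n) (μ : ℂ), ‖μ‖ = 1 → E A = μ • A → ∃ y : MatC r, A = R * y * Rᴴ) ∧
      (∀ a : MatC r, R * a * Rᴴ = 0 → a = 0) := by
  obtain ⟨N, K, hK⟩ := kraus E hE.1
  have hp : PosMap E := posMap_of_kraus hK
  have hPB := pb_of_channel hp hE.2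
  obtain ⟨r, R, B, ht, hB, hfix, hsupp⟩ := compress hK hPB
  let F : MatC r →ₗ[ℂ] MatC r := ∑ i, LinearMap.mulLeft ℂ (B i) ∘ₗ LinearMap.mulRight ℂ (B i)ᴴ
  have hF : ∀ a, F a = ∑ i, B i * a * (B i)ᴴ := by
    intro a
    simp [F, LinearMap.sum_apply, Matrix.mul_assoc]
  set t := Rᴴ * R with htdef
  have htu : IsUnit t.det := (Matrix.isUnit_iff_isUnit_det t).1 ht.isUnit
  have hEF : ∀ a, E (R * a * Rᴴ) = R * F a * Rᴴ := by intro a; rw [hB, hF]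
  have hLR : (t⁻¹ * Rᴴ) * R = 1 := by rw [Matrix.mul_assoc, ← htdef, Matrix.nonsing_inv_mul _ htu]
  have hLR' : Rᴴ * (t⁻¹ * Rᴴ)ᴴ = 1 := by
    have := congrArg Matrix.conjTranspose hLR
    rwa [Matrix.conjTranspose_mul, Matrix.conjTranspose_one] at this
  have hL : ∀ a : MatC r, (t⁻¹ * Rᴴ) * (R * a * Rᴴ) * (t⁻¹ * Rᴴ)ᴴ = a := by
    intro a
    calc (t⁻¹ * Rᴴ) * (R * a * Rᴴ) * (t⁻¹ * Rᴴ)ᴴ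
        = ((t⁻¹ * Rᴴ) * R) * a * (Rᴴ * (t⁻¹ * Rᴴ)ᴴ) := by simp only [Matrix.mul_assoc]
      _ = a := by rw [hLR, hLR', Matrix.one_mul, Matrix.mul_one]
  have hinj : ∀ a : MatC r, R * a * Rᴴ = 0 → a = 0 := by
    intro a ha
    rw [← hL a, ha]; simp
  have hpow : ∀ (k : ℕ) a, (E ^ k) (R * a * Rᴴ) = R * ((F ^ k) a) * Rᴴ := by
    intro k
    induction k with
    | zero => intro a; simp
    | succ k ih => intro a; rw [pow_succ', Module.End.mul_apply, ih, hEF, pow_succ', Module.End.mul_apply]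
  have hPBF : PB F := by
    intro φ a
    let ψ : MatC n →ₗ[ℂ] MatC r :=
      { toFun := fun X => (t⁻¹ * Rᴴ) * X * (t⁻¹ * Rᴴ)ᴴ
        map_add' := by intro x y; simp only [Matrix.mul_add, Matrix.add_mul]
        map_smul' := by intro x y; simp only [Matrix.mul_smul, Matrix.smul_mul, RingHom.id_apply] }
    obtain ⟨C, hC⟩ := hPB (φ ∘ₗ ψ) (R * a * Rᴴ)
    refine ⟨C, fun k => ?_⟩
    have := hC k
    rw [hpow, LinearMap.comp_apply] at this
    have e : ψ (R * ((F ^ k) a) * Rᴴ) = (F ^ k) a := hL _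
    rwa [e] at this
  refine ⟨r, N, R, B, F, ⟨hF, ?_, ht, ?_, hPBF, ?_⟩, hEF, hsupp, hinj⟩
  · have := hEF 1
    rw [Matrix.mul_one, hfix] at this
    rw [← hL (F 1), ← this, ← hL 1, Matrix.mul_one]
  · have hh : ∀ a, (t * a).trace = (R * a * Rᴴ).trace := by
      intro a; rw [htdef, Matrix.mul_assoc, Matrix.trace_mul_comm, Matrix.mul_assoc]
    intro a
    rw [hh, hh, ← hEF, hE.2]
  · intro μ y hμ hy K'
    obtain ⟨w, c, hw, hwc⟩ := hPBF.decomp hμ (K' * y - y * (t * K' * t⁻¹))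
    refine ⟨c, ?_⟩
    obtain ⟨P, hP⟩ := sp_exists E μ
    obtain ⟨-, hP2, hP3, -⟩ := sp_props hPB hμ hP
    have hA : E (R * y * Rᴴ) = μ • (R * y * Rᴴ) := by
      rw [hEF, hy, Matrix.mul_smul, Matrix.smul_mul]
    have h1 := hyp_all hPB hyp hμ hP hA (R * K' * (t⁻¹ * Rᴴ))
    have h2 : R * K' * (t⁻¹ * Rᴴ) * (R * y * Rᴴ) - (R * y * Rᴴ) * (R * K' * (t⁻¹ * Rᴴ))
        = R * (K' * y - y * (t * K' * t⁻¹)) * Rᴴ := by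
      have e1 : R * K' * (t⁻¹ * Rᴴ) * (R * y * Rᴴ) = R * K' * ((t⁻¹ * Rᴴ) * R) * y * Rᴴ := by
        simp only [Matrix.mul_assoc]
      have e2 : (R * y * Rᴴ) * (R * K' * (t⁻¹ * Rᴴ)) = R * y * (Rᴴ * R) * K' * t⁻¹ * Rᴴ := by
        simp only [Matrix.mul_assoc]
      rw [e1, hLR, e2, ← htdef]
      simp only [Matrix.mul_sub, Matrix.sub_mul, Matrix.mul_assoc, Matrix.one_mul]
    have h3 : R * (K' * y - y * (t * K' * t⁻¹)) * Rᴴ = R * w * Rᴴ + (E (R * c * Rᴴ) - μ • (R * c * Rᴴ)) := by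
      rw [hwc, hEF]
      simp only [Matrix.mul_sub, Matrix.sub_mul, Matrix.mul_add, Matrix.add_mul, Matrix.mul_smul, Matrix.smul_mul]
    rw [h2, h3, map_add, hP3, add_zero, hP2 _ (by rw [hEF, hw, Matrix.mul_smul, Matrix.smul_mul])] at h1
    rw [hwc, hinj w h1, zero_add]

/-! ### algebra of the compressed peripheral eigenoperators -/

theorem herm_pow_trick {r : ℕ} {a D : MatC r} (ha : aᴴ = a) (k : ℕ) (h : D * a ^ k = 0) : D * a = 0 := by
  induction k with
  | zero => rw [pow_zero, mul_one] at h; rw [h, zero_mul]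
  | succ k ih =>
    cases k with
    | zero => simpa using h
    | succ k =>
      apply ih
      apply Matrix.self_mul_conjTranspose_eq_zero.1
      rw [Matrix.conjTranspose_mul, Matrix.conjTranspose_pow, ha, ← mul_assoc]
      have : D * a ^ (k + 1) * a ^ (k + 1) = D * a ^ (k + 1 + 1) * a ^ k := by
        rw [mul_assoc, mul_assoc, ← pow_add, ← pow_add]; congr 2; ring
      rw [this, h, zero_mul, zero_mul]

theorem eq_of_trace {r : ℕ} {A B : MatC r} (h : ∀ K : MatC r, (A * K).trace = (B * K).trace) : A = B := by
  have := h (A - B)ᴴ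
  rw [← sub_eq_zero, ← Matrix.trace_sub, ← sub_mul, Matrix.trace_mul_conjTranspose_self_eq_zero_iff] at this
  exact sub_eq_zero.1 this

theorem trace_t_zero {r : ℕ} {t X : MatC r} (ht : t.PosDef) (hX : X.PosSemidef) (h : (t * X).trace = 0) : X = 0 := by
  obtain ⟨m, C, rfl⟩ := psd_eq hX
  have htu : IsUnit t.det := (Matrix.isUnit_iff_isUnit_det t).1 ht.isUnit
  have h1 : (C * t * Cᴴ).trace = 0 := by
    rw [← h, Matrix.trace_mul_comm, ← Matrix.mul_assoc, Matrix.trace_mul_comm]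
  have h2 := (ht.posSemidef.mul_mul_conjTranspose_same C).trace_eq_zero_iff.1 h1
  have h3 := psd_ann ht.posSemidef h2
  have h4 : C = 0 := by
    have : C * t * t⁻¹ = C := by rw [Matrix.mul_assoc, Matrix.mul_nonsing_inv _ htu, Matrix.mul_one]
    rw [← this, h3, Matrix.zero_mul]
  rw [h4, Matrix.mul_zero]

theorem conj_mul_one {μ : ℂ} (hμ : ‖μ‖ = 1) : star μ * μ = 1 := by
  have := Complex.conj_mul' μ
  rw [hμ] at this; simpa using this

theorem norm_star_one {μ : ℂ} (hμ : ‖μ‖ = 1) : ‖star μ‖ = 1 := by rwa [norm_star]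

section
variable {r N : ℕ} {B : Fin N → MatC r} {t : MatC r} {F : MatC r →ₗ[ℂ] MatC r}

theorem Core.star_eig (h : Core B t F) {μ : ℂ} {y : MatC r} (hy : F y = μ • y) : F yᴴ = (star μ) • yᴴ := by
  have : F yᴴ = (F y)ᴴ := by
    rw [h.hF, h.hF, Matrix.conjTranspose_sum]
    refine Finset.sum_congr rfl fun i _ => ?_
    simp [Matrix.mul_assoc]
  rw [this, hy, Matrix.conjTranspose_smul]

theorem Core.comm (h : Core B t F) {μ : ℂ} (hμ : ‖μ‖ = 1) {y : MatC r} (hy : F y = μ • y) (i : Fin N) :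
    B i * y = μ • (y * B i) := by
  have hm := conj_mul_one hμ
  have e : ∑ i, (B i * y - μ • (y * B i)) * (B i * y - μ • (y * B i))ᴴ = F (y * yᴴ) - y * yᴴ := by
    have e1 : ∀ i, (B i * y - μ • (y * B i)) * (B i * y - μ • (y * B i))ᴴ
        = B i * (y * yᴴ) * (B i)ᴴ - star μ • (B i * y * (B i)ᴴ * yᴴ)
          - μ • (y * (B i * yᴴ * (B i)ᴴ)) + y * (B i * 1 * (B i)ᴴ) * yᴴ := by
      intro i
      simp only [Matrix.conjTranspose_sub, Matrix.conjTranspose_smul, Matrix.conjTranspose_mul, mul_sub, sub_mul,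
        Matrix.smul_mul, Matrix.mul_smul, smul_smul, hm, one_smul, mul_one, mul_assoc, smul_sub]
      abel
    simp only [e1]
    rw [Finset.sum_add_distrib, Finset.sum_sub_distrib, Finset.sum_sub_distrib, ← h.hF, ← Finset.smul_sum,
      ← Finset.sum_mul, ← h.hF, ← Finset.smul_sum, ← Finset.mul_sum, ← h.hF, ← Finset.sum_mul, ← Finset.mul_sum,
      ← h.hF, h.h1, hy, h.star_eig hy]
    simp only [Matrix.smul_mul, Matrix.mul_smul, smul_smul, hm, mul_comm μ, one_smul, mul_one]
    abel
  have hps : (F (y * yᴴ) - y * yᴴ).PosSemidef := by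
    rw [← e]; exact Matrix.posSemidef_sum _ fun i _ => Matrix.posSemidef_self_mul_conjTranspose _
  have h0 := trace_t_zero h.ht hps (by rw [mul_sub, Matrix.trace_sub, h.htr, sub_self])
  rw [h0] at e
  exact sub_eq_zero.1 (sum_sq_zero e i)

theorem Core.mul_right (h : Core B t F) {μ : ℂ} (hμ : ‖μ‖ = 1) {y : MatC r} (hy : F y = μ • y) (c : MatC r) :
    F (c * y) = μ • (F c * y) := by
  rw [h.hF, h.hF, Finset.sum_mul, Finset.smul_sum]
  refine Finset.sum_congr rfl fun i _ => ?_
  have := congrArg Matrix.conjTranspose (h.comm (norm_star_one hμ) (h.star_eig hy) i)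
  simp only [Matrix.conjTranspose_mul, Matrix.conjTranspose_smul, Matrix.conjTranspose_conjTranspose, star_star] at this
  rw [← mul_assoc, mul_assoc (B i * c), this, Matrix.mul_smul, ← mul_assoc]

theorem Core.mul_left (h : Core B t F) {μ : ℂ} (hμ : ‖μ‖ = 1) {y : MatC r} (hy : F y = μ • y) (c : MatC r) :
    F (y * c) = μ • (y * F c) := by
  rw [h.hF, h.hF, Finset.mul_sum, Finset.smul_sum]
  refine Finset.sum_congr rfl fun i _ => ?_
  rw [← mul_assoc, h.comm hμ hy]
  simp only [Matrix.smul_mul, mul_assoc]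

theorem Core.eig_mul (h : Core B t F) {μ ν : ℂ} (hμ : ‖μ‖ = 1) {y z : MatC r} (hy : F y = μ • y)
    (hz : F z = ν • z) : F (y * z) = (μ * ν) • (y * z) := by
  rw [h.mul_left hμ hy, hz, Matrix.mul_smul, smul_smul]

theorem Core.eig_pow (h : Core B t F) {μ : ℂ} (hμ : ‖μ‖ = 1) {y : MatC r} (hy : F y = μ • y) (k : ℕ) :
    F (y ^ k) = μ ^ k • y ^ k := by
  induction k with
  | zero => simp [h.h1]
  | succ k ih => rw [pow_succ', h.eig_mul hμ hy ih, pow_succ']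

theorem Core.central (h : Core B t F) {μ : ℂ} (hμ : ‖μ‖ = 1) {x y : MatC r} (hx : F x = x) (hy : F y = μ • y) :
    x * y = y * x := by
  obtain ⟨k, c', hk, hkc⟩ := h.hPB.decomp (μ := 1) (by simp) (t * x * t⁻¹)
  rw [one_smul] at hk hkc
  have key : ∀ {μ : ℂ} (hμ : ‖μ‖ = 1) {y : MatC r} (hy : F y = μ • y), x * y = y * k := by
    intro μ hμ y hy
    obtain ⟨c, hc⟩ := h.hZ μ y hμ hy x
    have hm := conj_mul_one hμ
    have e : x * y - y * k = F (c + Star.star μ • (y * c')) - μ • (c + Star.star μ • (y * c')) := by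
      rw [hkc] at hc
      have : x * y - y * k = F c - μ • c + y * (F c' - c') := by rw [← hc]; simp only [mul_add]; abel
      rw [this, map_add, map_smul, h.mul_left hμ hy, smul_smul, hm, one_smul, smul_add, smul_smul, mul_comm μ, hm, one_smul, mul_sub]
      abel
    have hw : F (x * y - y * k) = μ • (x * y - y * k) := by
      rw [map_sub, h.eig_mul (μ := 1) (by simp) (by rw [one_smul, hx]) hy, h.eig_mul (ν := 1) hμ hy (by rw [one_smul, hk]), one_mul, mul_one,
        smul_sub]
    exact sub_eq_zero.1 (h.hPB.jordan hμ hw (v := c + Star.star μ • (y * c')) (by rw [e]; abel))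
  have hxk : x = k := by simpa using key (μ := 1) (by simp) (y := 1) (by rw [h.h1, one_smul])
  rw [key hμ hy, ← hxk]

theorem Core.fix_comm_t (h : Core B t F) {x : MatC r} (hx : F x = x) : t * x = x * t := by
  have htu : IsUnit t.det := (Matrix.isUnit_iff_isUnit_det t).1 h.ht.isUnit
  apply eq_of_trace
  intro K
  obtain ⟨c, hc⟩ := h.hZ 1 1 (by simp) (by rw [h.h1, one_smul]) K
  rw [one_smul, mul_one, one_mul] at hc
  have h1 : (t * (x * (F c - c))).trace = 0 := by
    have := h.mul_left (μ := 1) (by simp) (by rw [one_smul, hx]) c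
    rw [one_smul] at this
    rw [mul_sub, ← this, mul_sub, Matrix.trace_sub, h.htr, sub_self]
  rw [← hc, mul_sub, mul_sub, Matrix.trace_sub, sub_eq_zero] at h1
  rw [mul_assoc, h1]
  calc (t * (x * (t * K * t⁻¹))).trace = ((t * (x * t * K)) * t⁻¹).trace := by simp only [mul_assoc]
    _ = (x * t * K).trace := by
      rw [Matrix.trace_mul_comm, ← mul_assoc, Matrix.nonsing_inv_mul _ htu, one_mul]

theorem Core.star_mul_fix (h : Core B t F) {μ : ℂ} (hμ : ‖μ‖ = 1) {y : MatC r} (hy : F y = μ • y) :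
    F (yᴴ * y) = yᴴ * y := by
  rw [h.eig_mul (norm_star_one hμ) (h.star_eig hy) hy, conj_mul_one hμ, one_smul]

theorem Core.mul_star_fix (h : Core B t F) {μ : ℂ} (hμ : ‖μ‖ = 1) {y : MatC r} (hy : F y = μ • y) :
    F (y * yᴴ) = y * yᴴ := by
  rw [h.eig_mul hμ hy (h.star_eig hy), mul_comm, conj_mul_one hμ, one_smul]

theorem Core.normal (h : Core B t F) {μ : ℂ} (hμ : ‖μ‖ = 1) {y : MatC r} (hy : F y = μ • y) :
    yᴴ * y = y * yᴴ := by
  have ha := h.star_mul_fix hμ hy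
  have hb := h.mul_star_fix hμ hy
  have hay := h.central hμ ha hy
  have hby := h.central hμ hb hy
  have hbs := h.central (norm_star_one hμ) hb (h.star_eig hy)
  have has := h.central (norm_star_one hμ) ha (h.star_eig hy)
  have hs : (yᴴ * y - y * yᴴ) * (yᴴ * y - y * yᴴ)ᴴ = 0 := by
    have e1 : (yᴴ * y) * (y * yᴴ) = (y * yᴴ) * (y * yᴴ) := by
      rw [← mul_assoc, hay]; simp only [mul_assoc]
    have e2 : (y * yᴴ) * (yᴴ * y) = (yᴴ * y) * (yᴴ * y) := by
      rw [← mul_assoc, hbs]; simp only [mul_assoc]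
    have e3 : (yᴴ * y) * (y * yᴴ) = (y * yᴴ) * (yᴴ * y) := by
      rw [h.central (μ := 1) (by simp) ha (by rw [one_smul, hb])]
    simp only [Matrix.conjTranspose_sub, Matrix.conjTranspose_mul, Matrix.conjTranspose_conjTranspose]
    rw [mul_sub, sub_mul, sub_mul, e1, e2, sub_self, zero_sub, neg_eq_zero, ← e1, e3, e2]
    simp
  exact sub_eq_zero.1 (Matrix.self_mul_conjTranspose_eq_zero.1 hs)

theorem Core.t_rel (h : Core B t F) {μ : ℂ} (hμ : ‖μ‖ = 1) {y : MatC r} (hy : F y = μ • y) :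
    t * (y * yᴴ) = yᴴ * t * y := by
  have htu : IsUnit t.det := (Matrix.isUnit_iff_isUnit_det t).1 h.ht.isUnit
  have key : y * yᴴ * t = t⁻¹ * yᴴ * t * y * t := by
    apply eq_of_trace
    intro K
    obtain ⟨c, hc⟩ := h.hZ μ y hμ hy K
    have h1 : (t * ((F c - μ • c) * yᴴ)).trace = 0 := by
      have e := h.mul_right (norm_star_one hμ) (h.star_eig hy) c
      have e' : F c * yᴴ = μ • F (c * yᴴ) := by
        rw [e, smul_smul, mul_comm, conj_mul_one hμ, one_smul]
      rw [sub_mul, e', mul_sub, Matrix.trace_sub, Matrix.mul_smul, Matrix.trace_smul, h.htr, Matrix.smul_mul,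
        Matrix.mul_smul, Matrix.trace_smul, sub_self]
    rw [← hc, sub_mul, mul_sub, Matrix.trace_sub, sub_eq_zero] at h1
    calc (y * yᴴ * t * K).trace = (t * (K * y * yᴴ)).trace := by
          rw [mul_assoc, Matrix.trace_mul_comm]; simp only [mul_assoc]
      _ = ((t * y * t * K) * (t⁻¹ * yᴴ)).trace := by rw [h1]; simp only [mul_assoc]
      _ = _ := by rw [Matrix.trace_mul_comm]; simp only [mul_assoc]
  have k2 : t * (y * yᴴ * t) * t⁻¹ = t * (t⁻¹ * yᴴ * t * y * t) * t⁻¹ := by rw [key]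
  have e1 : t * (y * yᴴ * t) * t⁻¹ = t * (y * yᴴ) * (t * t⁻¹) := by simp only [mul_assoc]
  have e2 : t * (t⁻¹ * yᴴ * t * y * t) * t⁻¹ = (t * t⁻¹) * (yᴴ * t * y) * (t * t⁻¹) := by simp only [mul_assoc]
  rw [e1, e2, Matrix.mul_nonsing_inv _ htu, mul_one, mul_one, one_mul] at k2
  exact k2

theorem Core.comm_t (h : Core B t F) {μ : ℂ} (hμ : ‖μ‖ = 1) {y : MatC r} (hy : F y = μ • y) :
    t * y = y * t := by
  have h1 := h.t_rel hμ hy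
  have h2 := h.t_rel (norm_star_one hμ) (h.star_eig hy)
  rw [Matrix.conjTranspose_conjTranspose] at h2
  have ht : tᴴ = t := h.ht.isHermitian
  set D := t * y - y * t with hD
  have hDy : D * yᴴ = 0 := by
    rw [hD, sub_mul, ← h2, h.normal hμ hy, mul_assoc, sub_self]
  have hDt : D * t * yᴴ = 0 := by
    apply Matrix.self_mul_conjTranspose_eq_zero.1
    have e : D * t * yᴴ * (D * t * yᴴ)ᴴ = D * (t * (yᴴ * y)) * t * Dᴴ := by
      simp only [Matrix.conjTranspose_mul, Matrix.conjTranspose_conjTranspose, ht, mul_assoc]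
    rw [e, h.fix_comm_t (h.star_mul_fix hμ hy)]
    have e' : D * (yᴴ * y * t) * t * Dᴴ = (D * yᴴ) * y * t * t * Dᴴ := by simp only [mul_assoc]
    rw [e', hDy]; simp
  apply sub_eq_zero.1
  apply Matrix.self_mul_conjTranspose_eq_zero.1
  rw [← hD]
  have e : Dᴴ = yᴴ * t - t * yᴴ := by
    rw [hD, Matrix.conjTranspose_sub, Matrix.conjTranspose_mul, Matrix.conjTranspose_mul, ht]
  rw [e, mul_sub, ← mul_assoc, ← mul_assoc, hDy, hDt]; simp

theorem Core.pow_ne (h : Core B t F) {μ : ℂ} (hμ : ‖μ‖ = 1) {y : MatC r} (hy : F y = μ • y) (h0 : y ≠ 0) (k : ℕ) :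
    y ^ k ≠ 0 := by
  intro hk
  have hc : Commute yᴴ y := h.normal hμ hy
  have h1 : (1 : MatC r) * (yᴴ * y) ^ k = 0 := by rw [hc.mul_pow, hk, mul_zero, mul_zero]
  have h2 := herm_pow_trick (by simp) k h1
  rw [one_mul] at h2
  exact h0 (Matrix.conjTranspose_mul_self_eq_zero.1 h2)

theorem Core.root (h : Core B t F) {μ : ℂ} (hμ : ‖μ‖ = 1) {y : MatC r} (hy : F y = μ • y) (h0 : y ≠ 0) :
    ∃ m : ℕ, 0 < m ∧ μ ^ m = 1 := by
  by_contra hcon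
  have hμ0 : μ ≠ 0 := by rintro rfl; simp at hμ
  have hlt : ∀ a b : ℕ, a < b → μ ^ a ≠ μ ^ b := by
    intro a b hab he
    refine hcon ⟨b - a, by omega, ?_⟩
    have h1 : μ ^ a * μ ^ (b - a) = μ ^ a * 1 := by rw [← pow_add, mul_one, he]; congr 1; omega
    exact mul_left_cancel₀ (pow_ne_zero _ hμ0) h1
  have hinj : Function.Injective fun k : ℕ => μ ^ k := by
    intro a b hab
    rcases lt_trichotomy a b with hl | hl | hl
    · exact absurd hab (hlt _ _ hl)
    · exact hl
    · exact absurd hab.symm (hlt _ _ hl)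
  refine Set.infinite_of_injective_forall_mem hinj (s := {ν | Module.End.HasEigenvalue F ν}) ?_
    (Module.End.finite_hasEigenvalue F)
  intro k
  exact Module.End.hasEigenvalue_of_hasEigenvector
    ⟨Module.End.mem_eigenspace_iff.2 (h.eig_pow hμ hy k), h.pow_ne hμ hy h0 k⟩

end

theorem cyc {μ ν : ℂ} {p q : ℕ} (hp : 0 < p) (hq : 0 < q) (hμ : μ ^ p = 1) (hν : ν ^ q = 1) :
    ∃ a b i j : ℕ, μ = (μ ^ a * ν ^ b) ^ i ∧ ν = (μ ^ a * ν ^ b) ^ j := by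
  have : NeZero (p * q) := ⟨(Nat.mul_pos hp hq).ne'⟩
  let u : rootsOfUnity (p * q) ℂ := rootsOfUnity.mkOfPowEq μ (by rw [pow_mul, hμ, one_pow])
  let v : rootsOfUnity (p * q) ℂ := rootsOfUnity.mkOfPowEq ν (by rw [mul_comm, pow_mul, hν, one_pow])
  obtain ⟨g, hg⟩ := IsCyclic.exists_monoid_generator (α := Subgroup.closure {u, v})
  have hu : u ∈ Subgroup.closure {u, v} := Subgroup.subset_closure (by simp)
  have hv : v ∈ Subgroup.closure {u, v} := Subgroup.subset_closure (by simp)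
  obtain ⟨i, hi⟩ := hg ⟨u, hu⟩
  obtain ⟨j, hj⟩ := hg ⟨v, hv⟩
  obtain ⟨m, n, hmn⟩ := Subgroup.mem_closure_pair.1 g.2
  obtain ⟨a, ha⟩ := mem_powers_iff_mem_zpowers.2 (⟨m, rfl⟩ : u ^ m ∈ Subgroup.zpowers u)
  obtain ⟨b, hb⟩ := mem_powers_iff_mem_zpowers.2 (⟨n, rfl⟩ : v ^ n ∈ Subgroup.zpowers v)
  have hu' : ((u : ℂˣ) : ℂ) = μ := rootsOfUnity.coe_mkOfPowEq _
  have hv' : ((v : ℂˣ) : ℂ) = ν := rootsOfUnity.coe_mkOfPowEq _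
  have hgv : (((g : rootsOfUnity (p * q) ℂ) : ℂˣ) : ℂ) = μ ^ a * ν ^ b := by
    rw [← hmn]
    simp only at ha hb
    rw [← ha, ← hb]
    simp [hu', hv']
  refine ⟨a, b, i, j, ?_, ?_⟩
  · rw [← hgv, ← hu']
    have := congrArg (fun x : Subgroup.closure {u, v} => (((x : rootsOfUnity (p * q) ℂ) : ℂˣ) : ℂ)) hi
    simpa using this.symm
  · rw [← hgv, ← hv']
    have := congrArg (fun x : Subgroup.closure {u, v} => (((x : rootsOfUnity (p * q) ℂ) : ℂˣ) : ℂ)) hj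
    simpa using this.symm

section
variable {r N : ℕ} {B : Fin N → MatC r} {t : MatC r} {F : MatC r →ₗ[ℂ] MatC r}

theorem Core.commute (h : Core B t F) {μ ν : ℂ} (hμ : ‖μ‖ = 1) (hν : ‖ν‖ = 1) {y z : MatC r}
    (hy : F y = μ • y) (hz : F z = ν • z) : y * z = z * y := by
  by_cases hy0 : y = 0
  · simp [hy0]
  by_cases hz0 : z = 0
  · simp [hz0]
  obtain ⟨p, hp, hμp⟩ := h.root hμ hy hy0
  obtain ⟨q, hq, hνq⟩ := h.root hν hz hz0
  obtain ⟨a, b, i, j, hi, hj⟩ := cyc hp hq hμp hνq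
  set ω := μ ^ a * ν ^ b with hω
  have hωn : ‖ω‖ = 1 := by rw [hω, norm_mul, norm_pow, norm_pow, hμ, hν]; simp
  set w := y ^ a * z ^ b with hw
  have hwe : F w = ω • w := h.eig_mul (by rw [norm_pow, hμ, one_pow]) (h.eig_pow hμ hy a) (h.eig_pow hν hz b)
  have hwn : Commute wᴴ w := h.normal hωn hwe
  have hws := h.star_eig hwe
  have hfixc : ∀ {μ : ℂ} {y : MatC r} {i : ℕ}, ‖μ‖ = 1 → F y = μ • y → μ = ω ^ i → F (y * wᴴ ^ i) = y * wᴴ ^ i := by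
    intro μ y i hμ hy hi
    rw [h.eig_mul hμ hy (h.eig_pow (norm_star_one hωn) hws i)]
    have : μ * star ω ^ i = 1 := by rw [hi, ← mul_pow, mul_comm, conj_mul_one hωn, one_pow]
    rw [this, one_smul]
  set c := y * wᴴ ^ i with hc
  set c' := z * wᴴ ^ j with hc'
  have hcf : F c = c := hfixc hμ hy hi
  have hcf' : F c' = c' := hfixc hν hz hj
  set g := wᴴ * w with hg
  have hgf : F g = g := h.star_mul_fix hωn hwe
  have hyg : y * g ^ i = c * w ^ i := by rw [hg, hwn.mul_pow, ← mul_assoc]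
  have hzg : z * g ^ j = c' * w ^ j := by rw [hg, hwn.mul_pow, ← mul_assoc]
  have gy : Commute g y := h.central hμ hgf hy
  have gz : Commute g z := h.central hν hgf hz
  have cw : Commute c w := h.central hωn hcf hwe
  have cw' : Commute c' w := h.central hωn hcf' hwe
  have cc : Commute c c' := h.central (μ := 1) (by simp) hcf (by rw [one_smul, hcf'])
  clear_value c c'
  have e1 : y * z * g ^ (i + j) = c * c' * w ^ (i + j) := by
    calc y * z * g ^ (i + j) = (y * g ^ i) * (z * g ^ j) := by
          rw [pow_add, mul_assoc, mul_assoc, ← mul_assoc z, ← mul_assoc (g ^ i), (gz.pow_left i).eq]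
      _ = _ := by
          rw [hyg, hzg, pow_add, mul_assoc, mul_assoc, ← mul_assoc (w ^ i), ← (cw'.pow_right i).eq, mul_assoc]
  have e2 : z * y * g ^ (i + j) = c * c' * w ^ (i + j) := by
    calc z * y * g ^ (i + j) = (z * g ^ j) * (y * g ^ i) := by
          rw [add_comm, pow_add, mul_assoc, mul_assoc, ← mul_assoc y, ← mul_assoc (g ^ j), (gy.pow_left j).eq]
      _ = _ := by
          rw [hyg, hzg, cc.eq, add_comm, pow_add, mul_assoc, mul_assoc, ← mul_assoc (w ^ j), ← (cw.pow_right j).eq, mul_assoc]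
  set D := y * z - z * y with hD
  have hDg : D * g ^ (i + j) = 0 := by rw [hD, sub_mul, e1, e2, sub_self]
  have hyn : Commute yᴴ y := h.normal hμ hy
  have hzn : Commute zᴴ z := h.normal hν hz
  have hyf := h.star_mul_fix hμ hy
  have hzf := h.star_mul_fix hν hz
  have yyz : Commute (yᴴ * y) z := h.central hν hyf hz
  have yyzs : Commute (yᴴ * y) zᴴ := h.central (norm_star_one hν) hyf (h.star_eig hz)
  have zzy : Commute (zᴴ * z) y := h.central hμ hzf hy
  have zzys : Commute (zᴴ * z) yᴴ := h.central (norm_star_one hμ) hzf (h.star_eig hy)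
  have yyzz : Commute (yᴴ * y) (zᴴ * z) := yyzs.mul_right yyz
  have hg2 : g = (yᴴ * y) ^ a * (zᴴ * z) ^ b := by
    rw [hg, hw, Matrix.conjTranspose_mul, Matrix.conjTranspose_pow, Matrix.conjTranspose_pow]
    calc zᴴ ^ b * yᴴ ^ a * (y ^ a * z ^ b) = zᴴ ^ b * (yᴴ ^ a * y ^ a) * z ^ b := by simp only [mul_assoc]
      _ = (yᴴ * y) ^ a * (zᴴ * z) ^ b := by
        rw [← hyn.mul_pow, ← (yyzs.pow_pow a b).eq, mul_assoc, ← hzn.mul_pow]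
  set G := (yᴴ * y) * (zᴴ * z) with hG
  set s := (i + j) with hs
  have hDG : D * G ^ ((a + b) * s) = 0 := by
    have : G ^ ((a + b) * s) = g ^ s * ((yᴴ * y) ^ (b * s) * (zᴴ * z) ^ (a * s)) := by
      rw [hG, hg2, yyzz.mul_pow, (yyzz.pow_pow a b).mul_pow, ← pow_mul, ← pow_mul]
      rw [mul_assoc, ← mul_assoc ((zᴴ * z) ^ (b * s)), ← (yyzz.pow_pow (b * s) (b * s)).eq, mul_assoc, ← pow_add, ← mul_assoc,
        ← pow_add]
      congr 2 <;> ring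
    rw [this, ← mul_assoc, hDg, zero_mul]
  have hGh : Gᴴ = G := by
    rw [hG]
    simp only [Matrix.conjTranspose_mul, Matrix.conjTranspose_conjTranspose]
    exact yyzz.eq.symm
  have hDG1 := herm_pow_trick hGh _ hDG
  have f1 : (y * z)ᴴ * (y * z) = G := by
    rw [Matrix.conjTranspose_mul]
    calc zᴴ * yᴴ * (y * z) = zᴴ * (yᴴ * y) * z := by simp only [mul_assoc]
      _ = G := by rw [← yyzs.eq, mul_assoc]
  have f2 : (z * y)ᴴ * (z * y) = G := by
    rw [Matrix.conjTranspose_mul]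
    calc yᴴ * zᴴ * (z * y) = yᴴ * (zᴴ * z) * y := by simp only [mul_assoc]
      _ = G := by rw [mul_assoc, zzy.eq, ← mul_assoc, hG]
  have tr : ∀ X : MatC r, Xᴴ * X = G → D * Xᴴ = 0 := by
    intro X hX
    apply Matrix.self_mul_conjTranspose_eq_zero.1
    rw [Matrix.conjTranspose_mul, Matrix.conjTranspose_conjTranspose, mul_assoc, ← mul_assoc Xᴴ, hX, ← mul_assoc, hDG1, zero_mul]
  apply sub_eq_zero.1
  apply Matrix.self_mul_conjTranspose_eq_zero.1
  rw [← hD]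
  have : Dᴴ = (y * z)ᴴ - (z * y)ᴴ := by rw [hD, Matrix.conjTranspose_sub]
  rw [this, mul_sub, tr _ f1, tr _ f2, sub_zero]

end

theorem artin_idem {S : Type} [CommRing S] [Algebra ℂ S] [Module.Finite ℂ S] [IsReduced S] :
    ∃ (K : ℕ) (e : Fin K → S), (∀ j k, e j * e k = if j = k then e j else 0) ∧ (∀ k, e k ≠ 0) ∧
      ∑ k, e k = 1 ∧ ∀ s, ∃ c : Fin K → ℂ, s = ∑ k, c k • e k := by
  classical
  have : IsArtinianRing S := IsArtinianRing.of_finite ℂ S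
  have : Fintype (MaximalSpectrum S) := Fintype.ofFinite _
  let φ := IsArtinianRing.equivPi S
  have hφ : ∀ s I, φ s I = Ideal.Quotient.mk I.asIdeal s := fun s I => rfl
  let e0 : MaximalSpectrum S → S := fun I => φ.symm (Pi.single I 1)
  have he0 : ∀ I, φ (e0 I) = Pi.single I 1 := fun I => φ.apply_symm_apply _
  have hspan : ∀ s, ∃ c : MaximalSpectrum S → ℂ, s = ∑ I, c I • e0 I := by
    intro s
    have hb : ∀ I : MaximalSpectrum S, ∃ c : ℂ, algebraMap ℂ (S ⧸ I.asIdeal) c = Ideal.Quotient.mk I.asIdeal s := by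
      intro I
      have := I.isMaximal
      let _ : Field (S ⧸ I.asIdeal) := Ideal.Quotient.field I.asIdeal
      exact (IsAlgClosed.algebraMap_bijective_of_isIntegral (k := ℂ) (K := S ⧸ I.asIdeal)).2 _
    choose c hc using hb
    refine ⟨c, ?_⟩
    apply φ.injective
    rw [map_sum]
    funext I
    rw [Finset.sum_apply, Finset.sum_eq_single_of_mem I (Finset.mem_univ _)]
    · rw [Algebra.smul_def, map_mul, he0, Pi.mul_apply, Pi.single_eq_same, mul_one, hφ, hφ, ← hc]
      rfl
    · intro J _ hJ
      rw [Algebra.smul_def, map_mul, he0, Pi.mul_apply, Pi.single_eq_of_ne hJ.symm, mul_zero]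
  let ε := Fintype.equivFin (MaximalSpectrum S)
  refine ⟨Fintype.card (MaximalSpectrum S), fun k => e0 (ε.symm k), ?_, ?_, ?_, ?_⟩
  · intro j k
    apply φ.injective
    rw [map_mul, he0, he0]
    split_ifs with hjk
    · subst hjk; rw [he0, ← Pi.single_mul, mul_one]
    · rw [map_zero]
      funext I
      by_cases h : I = ε.symm j
      · subst h
        rw [Pi.mul_apply, Pi.single_eq_of_ne (fun h => hjk (ε.symm.injective h)) (1 : _), mul_zero]; rfl
      · rw [Pi.mul_apply, Pi.single_eq_of_ne h, zero_mul]; rfl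
  · intro k hk
    have := congrArg φ hk
    rw [he0, map_zero] at this
    have h1 := congrFun this (ε.symm k)
    have hm := (ε.symm k).isMaximal
    rw [Pi.single_eq_same] at h1
    have : Nontrivial (S ⧸ (ε.symm k).asIdeal) := Ideal.Quotient.nontrivial_iff.2 hm.ne_top
    exact one_ne_zero h1
  · rw [ε.symm.sum_comp e0]
    apply φ.injective
    rw [map_sum, map_one]
    simp only [he0]
    exact Finset.univ_sum_single _
  · intro s
    obtain ⟨c, hc⟩ := hspan s
    refine ⟨fun k => c (ε.symm k), ?_⟩
    rw [ε.symm.sum_comp (fun I => c I • e0 I)]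
    exact hc

theorem core_idem {r N : ℕ} {B : Fin N → MatC r} {t : MatC r} {F : MatC r →ₗ[ℂ] MatC r} (h : Core B t F) :
    ∃ (K : ℕ) (q : Fin K → MatC r) (f : Equiv.Perm (Fin K)),
      (∀ k, (q k)ᴴ = q k) ∧ (∀ j k, q j * q k = if j = k then q j else 0) ∧ (∀ k, q k ≠ 0) ∧
      (∀ k, F (q k) = q (f k)) ∧ (∀ k, t * q k = q k * t) ∧
      (∀ x, x ∈ Submodule.span ℂ {y : MatC r | ∃ μ : ℂ, ‖μ‖ = 1 ∧ F y = μ • y} ↔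
        ∃ c : Fin K → ℂ, x = ∑ k, c k • q k) := by
  classical
  set G : Set (MatC r) := {y : MatC r | ∃ μ : ℂ, ‖μ‖ = 1 ∧ F y = μ • y} with hG
  have hGc : ∀ a ∈ G, ∀ b ∈ G, a * b = b * a := by
    rintro a ⟨μ, hμ, ha⟩ b ⟨ν, hν, hb⟩
    exact h.commute hμ hν ha hb
  have hGcl : (Submonoid.closure G : Set (MatC r)) ⊆ G := by
    let M : Submonoid (MatC r) :=
      { carrier := G
        one_mem' := ⟨1, by simp, by rw [h.h1, one_smul]⟩
        mul_mem' := by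
          rintro a b ⟨μ, hμ, ha⟩ ⟨ν, hν, hb⟩
          exact ⟨μ * ν, by rw [norm_mul, hμ, hν, one_mul], h.eig_mul hμ ha hb⟩ }
    exact (Submonoid.closure_le (S := M)).2 (fun x hx => hx)
  have hAS : ∀ x, x ∈ Algebra.adjoin ℂ G ↔ x ∈ Submodule.span ℂ G := by
    intro x
    rw [← Algebra.adjoin_eq_span_of_subset (R := ℂ) (s := G) (hGcl.trans Submodule.subset_span)]
    rfl
  have hcomm : ∀ x ∈ Submodule.span ℂ G, ∀ y ∈ Submodule.span ℂ G, x * y = y * x := by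
    intro x hx y hy
    induction hx using Submodule.span_induction with
    | mem x hx =>
      induction hy using Submodule.span_induction with
      | mem y hy => exact hGc x hx y hy
      | zero => simp
      | add a b _ _ ha hb => rw [mul_add, add_mul, ha, hb]
      | smul c a _ ha => rw [Matrix.mul_smul, Matrix.smul_mul, ha]
    | zero => simp
    | add a b _ _ ha hb => rw [mul_add, add_mul, ha, hb]
    | smul c a _ ha => rw [Matrix.mul_smul, Matrix.smul_mul, ha]
  have hstar : ∀ x ∈ Submodule.span ℂ G, xᴴ ∈ Submodule.span ℂ G := by
    intro x hx
    induction hx using Submodule.span_induction with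
    | mem x hx =>
      obtain ⟨μ, hμ, hx⟩ := hx
      exact Submodule.subset_span ⟨star μ, norm_star_one hμ, h.star_eig hx⟩
    | zero => simp
    | add a b _ _ ha hb => rw [Matrix.conjTranspose_add]; exact Submodule.add_mem _ ha hb
    | smul c a _ ha => rw [Matrix.conjTranspose_smul]; exact Submodule.smul_mem _ _ ha
  have hFm : ∀ x ∈ Submodule.span ℂ G, ∀ y, F (x * y) = F x * F y := by
    intro x hx y
    induction hx using Submodule.span_induction with
    | mem x hx =>
      obtain ⟨μ, hμ, hx⟩ := hx
      rw [h.mul_left hμ hx, hx, Matrix.smul_mul]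
    | zero => simp
    | add a b _ _ ha hb => rw [add_mul, map_add, map_add, ha, hb, add_mul]
    | smul c a _ ha => rw [Matrix.smul_mul, map_smul, ha, map_smul, Matrix.smul_mul]
  have hFS : ∀ x ∈ Submodule.span ℂ G, F x ∈ Submodule.span ℂ G := by
    intro x hx
    induction hx using Submodule.span_induction with
    | mem x hx =>
      obtain ⟨μ, hμ, hx'⟩ := hx
      rw [hx']; exact Submodule.smul_mem _ _ (Submodule.subset_span ⟨μ, hμ, hx'⟩)
    | zero => simp
    | add a b _ _ ha hb => rw [map_add]; exact Submodule.add_mem _ ha hb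
    | smul c a _ ha => rw [map_smul]; exact Submodule.smul_mem _ _ ha
  have htc : ∀ x ∈ Submodule.span ℂ G, t * x = x * t := by
    intro x hx
    induction hx using Submodule.span_induction with
    | mem x hx =>
      obtain ⟨μ, hμ, hx⟩ := hx
      exact h.comm_t hμ hx
    | zero => simp
    | add a b _ _ ha hb => rw [mul_add, add_mul, ha, hb]
    | smul c a _ ha => rw [Matrix.smul_mul, Matrix.mul_smul, ha]
  have hred : ∀ x ∈ Submodule.span ℂ G, ∀ k : ℕ, x ^ k = 0 → x = 0 := by
    intro x hx k hk
    have hc : Commute xᴴ x := hcomm _ (hstar x hx) _ hx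
    have h1 : (1 : MatC r) * (xᴴ * x) ^ k = 0 := by rw [hc.mul_pow, hk, mul_zero, mul_zero]
    have h2 := herm_pow_trick (by simp) k h1
    rw [one_mul] at h2
    exact Matrix.conjTranspose_mul_self_eq_zero.1 h2
  obtain ⟨K, q, hqS, hqq, hq0, hspan⟩ : ∃ (K : ℕ) (q : Fin K → MatC r), (∀ k, q k ∈ Submodule.span ℂ G) ∧
      (∀ j k, q j * q k = if j = k then q j else 0) ∧ (∀ k, q k ≠ 0) ∧
      (∀ x ∈ Submodule.span ℂ G, ∃ c : Fin K → ℂ, x = ∑ k, c k • q k) := by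
    let _ : CommRing (Algebra.adjoin ℂ G) := Algebra.adjoinCommRingOfComm ℂ hGc
    have : IsReduced (Algebra.adjoin ℂ G) := by
      refine ⟨fun x hx => ?_⟩
      obtain ⟨k, hk⟩ := hx
      apply Subtype.ext
      refine hred x.1 ((hAS _).1 x.2) k ?_
      have := congrArg Subtype.val hk
      exact this
    obtain ⟨K, e, he, he0, -, hs⟩ := artin_idem (S := Algebra.adjoin ℂ G)
    refine ⟨K, fun k => (e k).1, fun k => (hAS _).1 (e k).2, ?_, ?_, ?_⟩
    · intro j k
      have := congrArg Subtype.val (he j k)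
      split_ifs with hjk
      · rw [if_pos hjk] at this; exact this
      · rw [if_neg hjk] at this; exact this
    · intro k hk
      exact he0 k (Subtype.ext hk)
    · intro x hx
      obtain ⟨c, hc⟩ := hs ⟨x, (hAS _).2 hx⟩
      refine ⟨c, ?_⟩
      have := congrArg (Algebra.adjoin ℂ G).val hc
      rw [map_sum] at this
      exact this
  have hqh : ∀ k, (q k)ᴴ = q k := by
    intro k
    have hc := hcomm _ (hstar _ (hqS k)) _ (hqS k)
    have hi : q k * q k = q k := by rw [hqq, if_pos rfl]
    have hi' : (q k)ᴴ * (q k)ᴴ = (q k)ᴴ := by rw [← Matrix.conjTranspose_mul, hi]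
    set a := q k - (q k)ᴴ * q k with ha
    have e : aᴴ * a = 0 := by
      rw [ha, Matrix.conjTranspose_sub, Matrix.conjTranspose_mul, Matrix.conjTranspose_conjTranspose, sub_mul, mul_sub, mul_sub]
      have e1 : (q k)ᴴ * ((q k)ᴴ * q k) = (q k)ᴴ * q k := by rw [← mul_assoc, hi']
      have e2 : (q k)ᴴ * q k * q k = (q k)ᴴ * q k := by rw [mul_assoc, hi]
      have e3 : (q k)ᴴ * q k * ((q k)ᴴ * q k) = (q k)ᴴ * q k := by rw [mul_assoc, ← mul_assoc (q k), ← hc, mul_assoc, hi, e1]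
      rw [e1, e2, e3]; simp
    have e0 := Matrix.conjTranspose_mul_self_eq_zero.1 e
    have e1 : q k = (q k)ᴴ * q k := sub_eq_zero.1 e0
    rw [e1, Matrix.conjTranspose_mul, Matrix.conjTranspose_conjTranspose]
  have hmulq : ∀ (c : Fin K → ℂ) (j : Fin K), (∑ k, c k • q k) * q j = c j • q j := by
    intro c j
    rw [Finset.sum_mul, Finset.sum_eq_single_of_mem j (Finset.mem_univ _)]
    · rw [Matrix.smul_mul, hqq, if_pos rfl]
    · intro b _ hb; rw [Matrix.smul_mul, hqq, if_neg hb, smul_zero]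
  choose c hc using fun k => hspan _ (hFS _ (hqS k))
  have hcmul : ∀ k l j, F (q k) * F (q l) * q j = (c k j * c l j) • q j := by
    intro k l j
    rw [mul_assoc, hc l, hmulq, Matrix.mul_smul, hc k, hmulq, smul_smul, mul_comm]
  have hFqq : ∀ k l, F (q k) * F (q l) = if k = l then F (q k) else 0 := by
    intro k l
    rw [← hFm _ (hqS k), hqq]
    split_ifs <;> simp
  have hcid : ∀ k j, c k j * c k j = c k j := by
    intro k j
    have h1 := hcmul k k j
    rw [hFqq, if_pos rfl] at h1
    nth_rewrite 1 [hc k] at h1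
    rw [hmulq] at h1
    exact (smul_left_injective ℂ (hq0 j) h1).symm
  have hcorth : ∀ k l j, k ≠ l → c k j * c l j = 0 := by
    intro k l j hkl
    have h1 := hcmul k l j
    rw [hFqq, if_neg hkl, zero_mul] at h1
    exact (smul_eq_zero.1 h1.symm).resolve_right (hq0 j)
  have hex : ∀ k, ∃ j, c k j ≠ 0 := by
    intro k
    by_contra hcon
    push Not at hcon
    have hF0 : F (q k) = 0 := by rw [hc k]; simp [hcon]
    have hps : (q k).PosSemidef := by
      have := Matrix.posSemidef_conjTranspose_mul_self (q k)
      rwa [hqh, hqq, if_pos rfl] at this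
    exact hq0 k (trace_t_zero h.ht hps (by rw [← h.htr, hF0]; simp))
  choose f hf using hex
  have hf1 : ∀ k, c k (f k) = 1 := by
    intro k
    have := hcid k (f k)
    exact mul_left_cancel₀ (hf k) (by rw [this, mul_one])
  have hinj : Function.Injective f := by
    intro k l hkl
    by_contra hne
    have := hcorth k l (f k) hne
    rw [hf1, hkl, hf1] at this
    simp at this
  have hbij : Function.Bijective f := Finite.injective_iff_bijective.1 hinj
  refine ⟨K, q, Equiv.ofBijective f hbij, hqh, hqq, hq0, ?_, fun k => htc _ (hqS k), ?_⟩
  · intro k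
    rw [hc k, Finset.sum_eq_single_of_mem (f k) (Finset.mem_univ _), hf1, one_smul]
    · rfl
    · intro j _ hj
      obtain ⟨l, rfl⟩ := hbij.2 j
      have hkl : k ≠ l := fun h => hj (by rw [h])
      have := hcorth k l (f l) hkl
      rw [hf1, mul_one] at this
      rw [this, zero_smul]
  · intro x
    constructor
    · exact hspan x
    · rintro ⟨c, rfl⟩
      exact Submodule.sum_mem _ fun k _ => Submodule.smul_mem _ _ (hqS k)

/-! ### building the decomposition -/

theorem build {n K : ℕ} {E : MatC n →ₗ[ℂ] MatC n} (τ : Fin K → MatC n) (f : Equiv.Perm (Fin K))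
    (hτ : ∀ k, (τ k).PosSemidef) (hτ1 : ∀ k, (τ k).trace = 1) (horth : ∀ j k, j ≠ k → τ j * τ k = 0)
    (hE : ∀ k, E (τ k) = τ (f k)) (hX : ∀ A, A ∈ recSpace E ↔ ∃ c : Fin K → ℂ, A = ∑ k, c k • τ k) :
    ∃ D : PeripheralDecomposition E, ∀ k, D.d k = 1 := by
  choose m V lam hlam hV hVτ using fun k => psd_factor (τ k) (hτ k)
  let ρ : (k : Fin K) → Matrix (Fin (m k)) (Fin (m k)) ℂ := fun k => Matrix.diagonal fun i => (lam k i : ℂ)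
  have hρ : ∀ k, (ρ k).PosDef := by
    intro k
    refine Matrix.PosDef.diagonal fun i => ?_
    exact_mod_cast hlam k i
  have hρtr : ∀ k, (ρ k).trace = 1 := by
    intro k
    rw [← hτ1 k, hVτ k, Matrix.trace_mul_comm, ← Matrix.mul_assoc, hV, Matrix.one_mul]
  let e : (k : Fin K) → Fin 1 × Fin (m k) ≃ Fin (m k) := fun k => Equiv.uniqueProd (Fin (m k)) (Fin 1)
  have hterm : ∀ k (x : Matrix (Fin 1) (Fin 1) ℂ),
      ((V k).submatrix id (e k)) * (x ⊗ₖ ρ k) * ((V k).submatrix id (e k))ᴴ = x 0 0 • τ k := by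
    intro k x
    have h1 : x ⊗ₖ ρ k = (x 0 0 • ρ k).submatrix (e k) (e k) := by
      ext ⟨a, i⟩ ⟨b, j⟩
      rw [Subsingleton.elim a 0, Subsingleton.elim b 0]
      simp [e]
    rw [h1, Matrix.conjTranspose_submatrix, Matrix.submatrix_mul_equiv, Matrix.submatrix_mul_equiv, Matrix.submatrix_id_id,
      Matrix.mul_smul, Matrix.smul_mul, hVτ k]
  have hVV : ∀ j k, j ≠ k → (V j)ᴴ * V k = 0 := by
    intro j k hjk
    have h1 := horth j k hjk
    rw [hVτ j, hVτ k] at h1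
    change V j * ρ j * (V j)ᴴ * (V k * ρ k * (V k)ᴴ) = 0 at h1
    have h2 : ρ j * ((V j)ᴴ * V k) * ρ k = 0 := by
      calc ρ j * ((V j)ᴴ * V k) * ρ k = ((V j)ᴴ * V j) * (ρ j * ((V j)ᴴ * V k) * ρ k) * ((V k)ᴴ * V k) := by
            rw [hV, hV, Matrix.one_mul, Matrix.mul_one]
        _ = (V j)ᴴ * (V j * ρ j * (V j)ᴴ * (V k * ρ k * (V k)ᴴ)) * V k := by simp only [Matrix.mul_assoc]
        _ = 0 := by rw [h1]; simp
    have hu : ∀ k, IsUnit (ρ k).det := fun k => (Matrix.isUnit_iff_isUnit_det _).1 (hρ k).isUnit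
    calc (V j)ᴴ * V k = ((ρ j)⁻¹ * ρ j) * ((V j)ᴴ * V k) * (ρ k * (ρ k)⁻¹) := by
          rw [Matrix.nonsing_inv_mul _ (hu j), Matrix.mul_nonsing_inv _ (hu k), Matrix.one_mul, Matrix.mul_one]
      _ = (ρ j)⁻¹ * (ρ j * ((V j)ᴴ * V k) * ρ k) * (ρ k)⁻¹ := by simp only [Matrix.mul_assoc]
      _ = 0 := by rw [h2]; simp
  have hsub : ∀ j k, ((V j).submatrix id (e j))ᴴ * (V k).submatrix id (e k) = ((V j)ᴴ * V k).submatrix (e j) (e k) := by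
    intro j k
    rw [Matrix.conjTranspose_submatrix, Matrix.submatrix_mul _ _ _ id _ Function.bijective_id]
  refine ⟨{ K := K, d := fun _ => 1, m := m, hd := fun _ => Nat.one_pos, hm := ?_,
            V := fun k => (V k).submatrix id (e k), ρ := ρ, U := fun _ => 1, perm := f.symm,
            hperm := fun _ => rfl, hViso := ?_, hVorth := ?_, hρpos := hρ, hρtr := hρtr,
            hU := fun _ => one_mem _, hX := ?_, hact := ?_ }, fun _ => rfl⟩
  · intro k
    rcases Nat.eq_zero_or_pos (m k) with h0 | h0
    · exfalso
      have : IsEmpty (Fin (m k)) := by rw [h0]; infer_instance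
      have h1 := hρtr k
      simp [Matrix.trace] at h1
    · exact h0
  · intro k
    rw [hsub, hV, Matrix.submatrix_one_equiv]
  · intro j k hjk
    rw [hsub, hVV j k hjk]; rfl
  · intro A
    rw [hX]
    simp only [hterm]
    constructor
    · rintro ⟨c, hc⟩
      exact ⟨fun k => Matrix.of fun _ _ => c k, hc⟩
    · rintro ⟨x, hx⟩
      exact ⟨fun k => x k 0 0, hx⟩
  · intro x
    simp only [hterm, map_sum, map_smul, hE, Matrix.conjTranspose_one, Matrix.one_mul, Matrix.mul_one]
    symm
    rw [← Equiv.sum_comp f]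
    refine Finset.sum_congr rfl fun k _ => ?_
    simp

theorem forward {n : ℕ} {E : MatC n →ₗ[ℂ] MatC n} (hE : IsQuantumChannel E)
    (hyp : ∀ S : Finset ℂ, (∀ μ : ℂ, μ ∈ S ↔ (Module.End.HasEigenvalue E μ ∧ ‖μ‖ = 1)) →
      ∀ P : ℂ → (MatC n →ₗ[ℂ] MatC n), (∀ μ ∈ S, IsSpectralProjection E (P μ) μ) →
      ∀ H : MatC n, H.IsHermitian →
      ∀ A : MatC n, ∑ μ ∈ S, P μ (H * P μ A - P μ A * H) = 0) :
    ∃ D : PeripheralDecomposition E, ∀ k, D.d k = 1 := by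
  obtain ⟨r, N, R, B, F, hC, hEF, hsupp, hinj⟩ := core_exists hE hyp
  obtain ⟨K, q, f, hqh, hqq, hq0, hFq, htq, hspan⟩ := core_idem hC
  let ψ : MatC r →ₗ[ℂ] MatC n :=
    { toFun := fun X => R * X * Rᴴ
      map_add' := by intro x y; simp only [Matrix.mul_add, Matrix.add_mul]
      map_smul' := by intro x y; simp only [Matrix.mul_smul, Matrix.smul_mul, RingHom.id_apply] }
  have hψ : ∀ X, ψ X = R * X * Rᴴ := fun _ => rfl
  have hEψ : ∀ X, E (ψ X) = ψ (F X) := hEF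
  have hψ0 : ∀ X, ψ X = 0 → X = 0 := hinj
  have hrec : recSpace E = (Submodule.span ℂ {y : MatC r | ∃ μ : ℂ, ‖μ‖ = 1 ∧ F y = μ • y}).map ψ := by
    apply le_antisymm
    · refine iSup_le fun μ => iSup_le fun hμ => ?_
      intro A hA
      rw [Module.End.mem_eigenspace_iff] at hA
      obtain ⟨y, hy⟩ := hsupp A μ hμ hA
      refine ⟨y, Submodule.subset_span ⟨μ, hμ, ?_⟩, hy.symm⟩
      apply sub_eq_zero.1
      apply hψ0
      rw [map_sub, map_smul, ← hEψ, hψ y, ← hy, hA, sub_self]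
    · rw [Submodule.map_span, Submodule.span_le]
      rintro _ ⟨y, ⟨μ, hμ, hy⟩, rfl⟩
      refine Submodule.mem_iSup_of_mem μ (Submodule.mem_iSup_of_mem hμ ?_)
      rw [Module.End.mem_eigenspace_iff, hEψ, hy, map_smul]
  have hσ : ∀ k, (ψ (q k)).PosSemidef := by
    intro k
    have h1 : (q k).PosSemidef := by
      have := Matrix.posSemidef_conjTranspose_mul_self (q k)
      rwa [hqh, hqq, if_pos rfl] at this
    exact h1.mul_mul_conjTranspose_same R
  have hp0 : ∀ k, (ψ (q k)).trace ≠ 0 := by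
    intro k h0
    exact hq0 k (hψ0 _ ((hσ k).trace_eq_zero_iff.1 h0))
  have hpf : ∀ k, (ψ (q (f k))).trace = (ψ (q k)).trace := by
    intro k; rw [← hFq, ← hEψ, hE.2]
  refine build (fun k => ((ψ (q k)).trace)⁻¹ • ψ (q k)) f ?_ ?_ ?_ ?_ ?_
  · intro k
    exact (hσ k).smul (inv_nonneg.2 (hσ k).trace_nonneg)
  · intro k
    rw [Matrix.trace_smul, smul_eq_mul, inv_mul_cancel₀ (hp0 k)]
  · intro j k hjk
    have : ψ (q j) * ψ (q k) = 0 := by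
      rw [hψ, hψ]
      calc R * q j * Rᴴ * (R * q k * Rᴴ) = R * (q j * (Rᴴ * R * q k)) * Rᴴ := by simp only [Matrix.mul_assoc]
        _ = R * (q j * q k * (Rᴴ * R)) * Rᴴ := by rw [htq k, Matrix.mul_assoc (q j)]
        _ = 0 := by rw [hqq, if_neg hjk]; simp
    rw [Matrix.smul_mul, Matrix.mul_smul, this, smul_zero, smul_zero]
  · intro k
    rw [map_smul, hEψ, hFq, hpf]
  · intro A
    rw [hrec]
    constructor
    · rintro ⟨x, hx, rfl⟩
      obtain ⟨c, rfl⟩ := (hspan x).1 hx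
      refine ⟨fun k => c k * (ψ (q k)).trace, ?_⟩
      rw [map_sum]
      refine Finset.sum_congr rfl fun k _ => ?_
      rw [map_smul, smul_smul, mul_assoc, mul_inv_cancel₀ (hp0 k), mul_one]
    · rintro ⟨c, rfl⟩
      refine ⟨∑ k, (c k * ((ψ (q k)).trace)⁻¹) • q k, (hspan _).2 ⟨_, rfl⟩, ?_⟩
      rw [map_sum]
      refine Finset.sum_congr rfl fun k _ => ?_
      rw [map_smul, smul_smul]

theorem main {n : ℕ} (E : MatC n →ₗ[ℂ] MatC n)
    (hE : IsQuantumChannel E) :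
    ((∀ S : Finset ℂ, (∀ μ : ℂ, μ ∈ S ↔ (Module.End.HasEigenvalue E μ ∧ ‖μ‖ = 1)) →
      ∀ P : ℂ → (MatC n →ₗ[ℂ] MatC n), (∀ μ ∈ S, IsSpectralProjection E (P μ) μ) →
      ∀ H : MatC n, H.IsHermitian →
      ∀ A : MatC n, ∑ μ ∈ S, P μ (H * P μ A - P μ A * H) = 0)
    ↔ ∃ D : PeripheralDecomposition E, ∀ k, D.d k = 1) := by
  constructor
  · exact forward hE
  · rintro ⟨D, hD⟩ S hS P hP H hH A
    obtain ⟨N, K, hK⟩ := kraus E hE.1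
    have hp : PosMap E := posMap_of_kraus hK
    have hPB := pb_of_channel hp hE.2
    refine Finset.sum_eq_zero fun μ hμ => ?_
    have hμ1 := ((hS μ).1 hμ).2
    exact backward E hp hE.2 D hD hμ1 (hP μ hμ) hH _ ((sp_props hPB hμ1 (hP μ hμ)).1 A)

end ZenoAux

/-- **Condition for Zeno Hamiltonian suppression (Theorem 2).**
Zeno Hamiltonian suppression by a quantum channel `𝓔` works — i.e. for every Hermitian
`H` the Zeno Hamiltonian `𝓗_Z = Σ_{|λ_ℓ|=1} P_ℓ ∘ [H,·] ∘ P_ℓ` vanishes identically —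
if and only if `𝓔` does not admit any decoherence-free subsystem (every block of the
structure decomposition of its space of recurrences has `d_k = 1`). -/
theorem zeno_suppression_iff_no_DFS {n : ℕ} (E : MatC n →ₗ[ℂ] MatC n)
    (hE : IsQuantumChannel E) :
    ((∀ S : Finset ℂ, (∀ μ : ℂ, μ ∈ S ↔ (Module.End.HasEigenvalue E μ ∧ ‖μ‖ = 1)) →
      ∀ P : ℂ → (MatC n →ₗ[ℂ] MatC n), (∀ μ ∈ S, IsSpectralProjection E (P μ) μ) →
      ∀ H : MatC n, H.IsHermitian →
      ∀ A : MatC n, ∑ μ ∈ S, P μ (H * P μ A - P μ A * H) = 0)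
    ↔ ∃ D : PeripheralDecomposition E, ∀ k, D.d k = 1) := by
  exact ZenoAux.main E hE
end
end

section
/- Let 𝓔 : B(ℋ) → B(ℋ) be a quantum channel whose peripheral spectral projections all have the form P_ℓ = Σ_{j=1}^{ν_ℓ} R_ℓ^(j) tr(L_ℓ^(j)† ·), where for each ℓ and each j the operators satisfy [R_ℓ^(j), L_ℓ^(j)†] = 0, and for i ≠ j the operators act on disjoint blocks, i.e. L_ℓ^(i)† R_ℓ^(j) = R_ℓ^(j) L_ℓ^(i)† = 0. Then for every Hermitian H ∈ B(ℋ), the Zeno Hamiltonian vanishes: Σ_{|λ_ℓ|=1} P_ℓ([H, P_ℓ(A)]) = 0 for all A ∈ B(ℋ). -/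
open Matrix Kronecker
open scoped ComplexOrder
noncomputable section

/-- **Zeno Hamiltonian suppression from the block form of the peripheral projections.**
If all peripheral spectral projections of a quantum channel `𝓔` have the form
`P_ℓ = Σⱼ R_ℓ⁽ʲ⁾ tr(L_ℓ⁽ʲ⁾† ·)` with `[R_ℓ⁽ʲ⁾, L_ℓ⁽ʲ⁾†] = 0` and
`L_ℓ⁽ⁱ⁾† R_ℓ⁽ʲ⁾ = R_ℓ⁽ʲ⁾ L_ℓ⁽ⁱ⁾† = 0` for `i ≠ j`, then the Zeno Hamiltonian vanishes:
`Σ_{|λ_ℓ|=1} P_ℓ([H, P_ℓ(A)]) = 0` for every Hermitian `H` and every `A`. -/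
theorem zeno_vanishes_of_block_projections {n : ℕ} (E : MatC n →ₗ[ℂ] MatC n)
    (hE : IsQuantumChannel E)
    (S : Finset ℂ) (hS : ∀ μ : ℂ, μ ∈ S ↔ (Module.End.HasEigenvalue E μ ∧ ‖μ‖ = 1))
    (ν : ℂ → ℕ)
    (hν : ∀ μ ∈ S, ν μ = Module.finrank ℂ (Module.End.maxGenEigenspace E μ))
    (P : ℂ → (MatC n →ₗ[ℂ] MatC n)) (hP : ∀ μ ∈ S, IsSpectralProjection E (P μ) μ)
    (R L : (μ : ℂ) → Fin (ν μ) → MatC n)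
    (hform : ∀ μ ∈ S, ∀ A : MatC n, P μ A = ∑ j, ((L μ j)ᴴ * A).trace • R μ j)
    (hcomm : ∀ μ ∈ S, ∀ j, R μ j * (L μ j)ᴴ = (L μ j)ᴴ * R μ j)
    (hdisj : ∀ μ ∈ S, ∀ i j, i ≠ j →
      (L μ i)ᴴ * R μ j = 0 ∧ R μ j * (L μ i)ᴴ = 0) :
    ∀ H : MatC n, H.IsHermitian →
      ∀ A : MatC n, ∑ μ ∈ S, P μ (H * P μ A - P μ A * H) = 0 := by
  intro H _ A
  apply Finset.sum_eq_zero
  intro μ hμ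
  have hc : ∀ i j, R μ j * (L μ i)ᴴ = (L μ i)ᴴ * R μ j := by
    intro i j
    by_cases h : i = j
    · subst h
      exact hcomm μ hμ i
    · rw [(hdisj μ hμ i j h).1, (hdisj μ hμ i j h).2]
  have hcP : ∀ i, P μ A * (L μ i)ᴴ = (L μ i)ᴴ * P μ A := by
    intro i
    rw [hform μ hμ A, Finset.sum_mul, Finset.mul_sum]
    refine Finset.sum_congr rfl fun j _ => ?_
    rw [Matrix.smul_mul, Matrix.mul_smul, hc]
  rw [hform μ hμ (H * P μ A - P μ A * H)]
  apply Finset.sum_eq_zero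
  intro i _
  have ht : ((L μ i)ᴴ * (H * P μ A - P μ A * H)).trace = 0 := by
    rw [Matrix.mul_sub, Matrix.trace_sub, Matrix.trace_mul_comm (L μ i)ᴴ (H * P μ A),
      Matrix.mul_assoc, hcP, ← Matrix.mul_assoc (L μ i)ᴴ, Matrix.trace_mul_comm H, sub_self]
  rw [ht, zero_smul]
end
end

section
/- Let 𝓔^d : B(ℂ²) → B(ℂ²) be the qubit completely dephasing channel 𝓔^d(A) = |0⟩⟨0|A|0⟩⟨0| + |1⟩⟨1|A|1⟩⟨1|, let 𝓘₁ be the identity map on B(ℂ₁²), and let H = Z⊗Z ∈ B(ℂ₁²⊗ℂ₂²) with 𝓗 = [H,·]. Then for every n ∈ ℕ, n ≥ 1, and every t ∈ ℝ, the bath dynamical decoupling evolution satisfies ((𝓘₁⊗𝓔^d) ∘ e^{−i(t/n)𝓗})^n (A) = (e^{−itZ}⊗|0⟩⟨0|) A (e^{itZ}⊗|0⟩⟨0|) + (e^{itZ}⊗|1⟩⟨1|) A (e^{−itZ}⊗|1⟩⟨1|) for all A ∈ B(ℂ₁²⊗ℂ₂²). In particular, the system-bath evolution is not decoupled for any n.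 -/
open Matrix Kronecker
open scoped ComplexOrder
noncomputable section

abbrev MatC2 (d₁ d₂ : ℕ) := Matrix (Fin d₁ × Fin d₂) (Fin d₁ × Fin d₂) ℂ

/-- The map `𝓘₁ ⊗ 𝓔` on operators of a bipartite system, acting as `𝓔` on the second factor. -/
def idTensor {d₁ d₂ : ℕ} (E : MatC d₂ →ₗ[ℂ] MatC d₂) : MatC2 d₁ d₂ →ₗ[ℂ] MatC2 d₁ d₂ where
  toFun M := Matrix.of fun p q => E (Matrix.of fun a b => M (p.1, a) (q.1, b)) p.2 q.2
  map_add' M N := by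
    ext p q
    have h : (Matrix.of fun a b => (M + N) (p.1, a) (q.1, b)) =
        (Matrix.of fun a b => M (p.1, a) (q.1, b)) +
          (Matrix.of fun a b => N (p.1, a) (q.1, b)) := rfl
    show E (Matrix.of fun a b => (M + N) (p.1, a) (q.1, b)) p.2 q.2 = _
    rw [h, map_add]
    rfl
  map_smul' c M := by
    ext p q
    have h : (Matrix.of fun a b => (c • M) (p.1, a) (q.1, b)) =
        c • (Matrix.of fun a b => M (p.1, a) (q.1, b)) := rfl
    show E (Matrix.of fun a b => (c • M) (p.1, a) (q.1, b)) p.2 q.2 = _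
    rw [h, _root_.map_smul]
    rfl

/-- The conjugation map `A ↦ E * A * F`. -/
def conjMap {n : ℕ} (E F : MatC n) : MatC n →ₗ[ℂ] MatC n where
  toFun A := E * A * F
  map_add' A B := by noncomm_ring
  map_smul' c A := by
    simp [Matrix.mul_smul, Matrix.smul_mul]

/-- The completely dephasing channel `𝓔ᵈ(A) = Σᵢ |i⟩⟨i| A |i⟩⟨i|`. -/
def dephasing (d : ℕ) : MatC d →ₗ[ℂ] MatC d :=
  ∑ i : Fin d, conjMap (Matrix.single i i 1) (Matrix.single i i 1)

/-- The conjugation map `A ↦ E * A * F` on two-qubit operators. -/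
def conjMap2 (E F : MatC2 2 2) : MatC2 2 2 →ₗ[ℂ] MatC2 2 2 where
  toFun A := E * A * F
  map_add' A B := by noncomm_ring
  map_smul' c A := by
    simp [Matrix.mul_smul, Matrix.smul_mul]

/-- The Pauli matrix `Z = |0⟩⟨0| - |1⟩⟨1|`. -/
def PauliZ : MatC 2 :=
  Matrix.single 0 0 1 - Matrix.single 1 1 1

/-- `e^{isZ}` for `s ∈ ℝ`. -/
def expItZ (s : ℝ) : MatC 2 :=
  NormedSpace.exp (((s : ℂ) * Complex.I) • PauliZ)

/-- `e^{is(Z⊗Z)}` for `s ∈ ℝ`. -/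
def expItZZ (s : ℝ) : MatC2 2 2 :=
  NormedSpace.exp (((s : ℂ) * Complex.I) • (PauliZ ⊗ₖ PauliZ))

/-- The diagonal of `Z`. -/
def zdiag : Fin 2 → ℂ := ![1, -1]

theorem PauliZ_eq_diagonal : PauliZ = Matrix.diagonal zdiag := by
  ext i j
  fin_cases i <;> fin_cases j <;> simp [PauliZ, zdiag, Matrix.single_apply]

theorem expItZ_eq (s : ℝ) :
    expItZ s = Matrix.diagonal (fun i => Complex.exp ((s : ℂ) * Complex.I * zdiag i)) := by
  rw [expItZ, PauliZ_eq_diagonal, ← Matrix.diagonal_smul, Matrix.exp_diagonal]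
  congr 1
  ext i
  rw [Pi.coe_exp, ← Complex.exp_eq_exp_ℂ]
  simp

theorem expItZZ_eq (s : ℝ) :
    expItZZ s = Matrix.diagonal
      (fun p => Complex.exp ((s : ℂ) * Complex.I * (zdiag p.1 * zdiag p.2))) := by
  rw [expItZZ, PauliZ_eq_diagonal, Matrix.diagonal_kronecker_diagonal,
    ← Matrix.diagonal_smul, Matrix.exp_diagonal]
  congr 1
  ext i
  rw [Pi.coe_exp, ← Complex.exp_eq_exp_ℂ]
  simp

theorem dephasing_two_apply (M : MatC 2) (i j : Fin 2) :
    dephasing 2 M i j = if i = j then M i j else 0 := by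
  fin_cases i <;> fin_cases j <;>
    simp [dephasing, conjMap, Matrix.mul_apply, Matrix.single_apply, Fin.sum_univ_two]

/-- One step of the decoupling cycle, entrywise. -/
theorem step_apply (s : ℝ) (A : MatC2 2 2) (p q : Fin 2 × Fin 2) :
    ((idTensor (dephasing 2)) ∘ₗ conjMap2 (expItZZ (-s)) (expItZZ s)) A p q
      = if p.2 = q.2 then
          Complex.exp ((s : ℂ) * Complex.I * (zdiag q.1 * zdiag q.2 - zdiag p.1 * zdiag p.2))
            * A p q else 0 := by
  simp only [LinearMap.comp_apply, idTensor, conjMap2, LinearMap.coe_mk, AddHom.coe_mk,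
    Matrix.of_apply, dephasing_two_apply, expItZZ_eq, Matrix.mul_diagonal, Matrix.diagonal_mul]
  split_ifs
  · rw [mul_right_comm, ← Complex.exp_add]
    congr 2
    push_cast
    ring
  · rfl

theorem pow_apply_entry (s : ℝ) (k : ℕ) (A : MatC2 2 2) (p q : Fin 2 × Fin 2) :
    (((idTensor (dephasing 2)) ∘ₗ conjMap2 (expItZZ (-s)) (expItZZ s)) ^ (k + 1)) A p q
      = if p.2 = q.2 then
          Complex.exp (((k + 1 : ℕ) : ℂ) * ((s : ℂ) * Complex.I *
            (zdiag q.1 * zdiag q.2 - zdiag p.1 * zdiag p.2))) * A p q else 0 := by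
  induction k with
  | zero => rw [zero_add, pow_one, step_apply]; simp
  | succ k ih =>
    rw [pow_succ', Module.End.mul_apply, step_apply, ih]
    split_ifs
    · rw [← mul_assoc, ← Complex.exp_add]
      congr 2
      push_cast
      ring
    · rfl

/-- **Bath dynamical decoupling with the dephasing channel does not decouple.**
For `H = Z⊗Z` and the bath kicks `𝓘₁ ⊗ 𝓔ᵈ`, the dynamical decoupling evolution satisfies,
for every `n ≥ 1` and every `t`,
`((𝓘₁⊗𝓔ᵈ) e^{−i(t/n)𝓗})ⁿ(A) = (e^{−itZ}⊗|0⟩⟨0|) A (e^{itZ}⊗|0⟩⟨0|)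
  + (e^{itZ}⊗|1⟩⟨1|) A (e^{−itZ}⊗|1⟩⟨1|)`,
so the system-bath evolution is not decoupled for any `n`. -/
theorem dephasing_bath_DD_fails (n : ℕ) (hn : 1 ≤ n) (t : ℝ) :
    ∀ A : MatC2 2 2,
      (((idTensor (dephasing 2)) ∘ₗ conjMap2 (expItZZ (-(t / n))) (expItZZ (t / n))) ^ n) A
        = (expItZ (-t) ⊗ₖ Matrix.single 0 0 1) * A
            * (expItZ t ⊗ₖ Matrix.single 0 0 1)
          + (expItZ t ⊗ₖ Matrix.single 1 1 1) * A
            * (expItZ (-t) ⊗ₖ Matrix.single 1 1 1) := by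
  intro A
  ext p q
  obtain ⟨k, rfl⟩ : ∃ k, n = k + 1 := ⟨n - 1, by omega⟩
  rw [pow_apply_entry]
  have hc : ((k + 1 : ℕ) : ℂ) ≠ 0 := Nat.cast_ne_zero.mpr (Nat.succ_ne_zero k)
  have e : ∀ w : ℂ, ((k + 1 : ℕ) : ℂ) * (((t / ((k + 1 : ℕ) : ℝ) : ℝ) : ℂ) * Complex.I * w)
      = (t : ℂ) * Complex.I * w := by
    intro w
    rw [Complex.ofReal_div, Complex.ofReal_natCast]
    field_simp
  have h0 : (Matrix.single 0 0 1 : MatC 2) = Matrix.diagonal ![1, 0] := by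
    ext i j
    fin_cases i <;> fin_cases j <;> simp [Matrix.single_apply]
  have h1 : (Matrix.single 1 1 1 : MatC 2) = Matrix.diagonal ![0, 1] := by
    ext i j
    fin_cases i <;> fin_cases j <;> simp [Matrix.single_apply]
  rw [e, h0, h1, expItZ_eq, expItZ_eq]
  simp only [Matrix.diagonal_kronecker_diagonal, Matrix.add_apply, Matrix.mul_diagonal,
    Matrix.diagonal_mul]
  obtain ⟨p1, p2⟩ := p
  obtain ⟨q1, q2⟩ := q
  have key : ∀ a b c x : ℂ, a + b = c → Complex.exp c * x = Complex.exp a * x * Complex.exp b := by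
    intro a b c x h
    rw [← h, Complex.exp_add]
    ring
  fin_cases p2 <;> fin_cases q2 <;> simp only [Fin.zero_eta, Fin.mk_one, Fin.isValue,
    Matrix.cons_val_zero, Matrix.cons_val_one, mul_one, mul_zero, zero_mul, add_zero, zero_add,
    if_true, zero_ne_one, one_ne_zero, if_false]
  · apply key
    simp [zdiag]
    ring
  · apply key
    simp [zdiag]
    ring
end
end

section
/- Let 𝓔^{𝟙/2} : B(ℂ₁²⊗ℂ₂²) → B(ℂ₁²⊗ℂ₂²) be the two-qubit channel 𝓔^{𝟙/2}(A) = tr₂(A) ⊗ 𝟙/2, and let H = Z⊗𝟙 with 𝓗 = [H,·]. Then: (i) 𝓗 commutes with 𝓔^{𝟙/2}, i.e. [𝓗, 𝓔^{𝟙/2}] = 0; and (ii) for every n ∈ ℕ, n ≥ 1, and every t ∈ ℝ, (𝓔^{𝟙/2} ∘ e^{−i(t/n)𝓗})^n = 𝓔^{𝟙/2} ∘ e^{−it𝓗}. In particular the Hamiltonian H is not suppressed by frequent kicks with 𝓔^{𝟙/2}, so Zeno Hamiltonian suppression fails for this channel. -/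
open Matrix Kronecker
open scoped ComplexOrder
noncomputable section

/-- Partial trace over the second tensor factor. -/
def ptr₂ {d₁ d₂ : ℕ} : MatC2 d₁ d₂ →ₗ[ℂ] MatC d₁ where
  toFun M := Matrix.of fun i j => ∑ a, M (i, a) (j, a)
  map_add' M N := by
    ext i j
    simp [Finset.sum_add_distrib]
  map_smul' c M := by
    ext i j
    simp [Finset.mul_sum]

/-- Kronecker product with a fixed matrix on the right, as a linear map. -/
def kronRight {d₁ d₂ : ℕ} (B : MatC d₂) : MatC d₁ →ₗ[ℂ] MatC2 d₁ d₂ where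
  toFun A := A ⊗ₖ B
  map_add' A A' := Matrix.add_kronecker A A' B
  map_smul' c A := Matrix.smul_kronecker c A B

/-- The two-qubit channel `𝓔^{𝟙/2}(A) = tr₂(A) ⊗ 𝟙/2`. -/
def Ehalf : MatC2 2 2 →ₗ[ℂ] MatC2 2 2 :=
  (kronRight ((2⁻¹ : ℂ) • (1 : MatC 2))) ∘ₗ ptr₂

/-- `e^{is(Z⊗𝟙)}` for `s ∈ ℝ`. -/
def expItH (s : ℝ) : MatC2 2 2 :=
  NormedSpace.exp (((s : ℂ) * Complex.I) • (PauliZ ⊗ₖ (1 : MatC 2)))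

def zsgn (i : Fin 2) : ℂ := if i = 0 then 1 else -1

theorem pauliZ_kron : (PauliZ ⊗ₖ (1 : MatC 2)) = Matrix.diagonal (fun p => zsgn p.1) := by
  ext ⟨i, a⟩ ⟨j, b⟩
  fin_cases i <;> fin_cases j <;> fin_cases a <;> fin_cases b <;>
    simp [PauliZ, zsgn, Matrix.diagonal, Matrix.single, Matrix.one_apply]

theorem expItH_eq (s : ℝ) :
    expItH s = Matrix.diagonal (fun p => Complex.exp ((s : ℂ) * Complex.I * zsgn p.1)) := by
  rw [expItH, pauliZ_kron, ← Matrix.diagonal_smul, Matrix.exp_diagonal]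
  congr 1
  ext p
  rw [Pi.coe_exp]
  simp [Complex.exp_eq_exp_ℂ]

theorem Ehalf_apply (A : MatC2 2 2) (i a j b : Fin 2) :
    Ehalf A (i, a) (j, b) = (∑ c, A (i, c) (j, c)) * (if a = b then 2⁻¹ else 0) := by
  simp [Ehalf, kronRight, ptr₂, Matrix.one_apply]

theorem conj_apply (s : ℝ) (A : MatC2 2 2) (i a j b : Fin 2) :
    conjMap2 (expItH (-s)) (expItH s) A (i, a) (j, b)
      = Complex.exp ((s : ℂ) * Complex.I * (zsgn j - zsgn i)) * A (i, a) (j, b) := by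
  simp only [conjMap2, expItH_eq, LinearMap.coe_mk, AddHom.coe_mk, Matrix.mul_diagonal,
    Matrix.diagonal_mul]
  rw [mul_right_comm, ← Complex.exp_add]
  congr 2
  push_cast
  ring

theorem step (s r : ℝ) :
    (Ehalf ∘ₗ conjMap2 (expItH (-s)) (expItH s)) * (Ehalf ∘ₗ conjMap2 (expItH (-r)) (expItH r))
      = Ehalf ∘ₗ conjMap2 (expItH (-(s + r))) (expItH (s + r)) := by
  refine LinearMap.ext fun A => ?_
  ext ⟨i, a⟩ ⟨j, b⟩
  simp only [Module.End.mul_apply, LinearMap.comp_apply, Ehalf_apply, conj_apply,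
    Fin.sum_univ_two, if_true]
  have : Complex.exp (((s + r : ℝ) : ℂ) * Complex.I * (zsgn j - zsgn i))
      = Complex.exp ((s : ℂ) * Complex.I * (zsgn j - zsgn i))
        * Complex.exp ((r : ℂ) * Complex.I * (zsgn j - zsgn i)) := by
    rw [← Complex.exp_add]
    congr 1
    push_cast
    ring
  rw [this]
  ring

theorem pow_step (s : ℝ) (n : ℕ) :
    (Ehalf ∘ₗ conjMap2 (expItH (-s)) (expItH s)) ^ (n + 1)
      = Ehalf ∘ₗ conjMap2 (expItH (-((n + 1 : ℕ) * s))) (expItH ((n + 1 : ℕ) * s)) := by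
  induction n with
  | zero => simp
  | succ k ih =>
    rw [pow_succ, ih, step]
    have : ((k + 1 : ℕ) : ℝ) * s + s = ((k + 1 + 1 : ℕ) : ℝ) * s := by
      push_cast
      ring
    rw [this]

/-- **Zeno Hamiltonian suppression fails for the channel `𝓔^{𝟙/2}` with a
decoherence-free subsystem.**  For `H = Z⊗𝟙`: (i) `𝓗 = [H,·]` commutes with `𝓔^{𝟙/2}`;
(ii) for every `n ≥ 1` and every `t`,
`(𝓔^{𝟙/2} e^{−i(t/n)𝓗})ⁿ = 𝓔^{𝟙/2} e^{−it𝓗}`; in particular, the Hamiltonian `H` is not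
suppressed by frequent kicks with `𝓔^{𝟙/2}`. -/
theorem ehalf_zeno_suppression_fails :
    (∀ A : MatC2 2 2,
      Ehalf ((PauliZ ⊗ₖ (1 : MatC 2)) * A - A * (PauliZ ⊗ₖ (1 : MatC 2)))
        = (PauliZ ⊗ₖ (1 : MatC 2)) * Ehalf A - Ehalf A * (PauliZ ⊗ₖ (1 : MatC 2))) ∧
    (∀ n : ℕ, 1 ≤ n → ∀ t : ℝ,
      ((Ehalf ∘ₗ conjMap2 (expItH (-(t / n))) (expItH (t / n))) ^ n)
        = Ehalf ∘ₗ conjMap2 (expItH (-t)) (expItH t)) := by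
  refine ⟨fun A => ?_, fun n hn t => ?_⟩
  · rw [pauliZ_kron]
    ext ⟨i, a⟩ ⟨j, b⟩
    simp only [Ehalf_apply, Matrix.sub_apply, Matrix.mul_diagonal, Matrix.diagonal_mul,
      Fin.sum_univ_two]
    ring
  · obtain ⟨k, rfl⟩ : ∃ k, n = k + 1 := ⟨n - 1, by omega⟩
    rw [pow_step, mul_div_cancel₀ t (by positivity)]
end
end

section
/- For p ∈ (0,1), let 𝓔^□ : B(ℂ³) → B(ℂ³) be the qutrit channel with Kraus operators K₁ = |2⟩⟨0|, K₂ = |2⟩⟨1|, K₃ = √p |0⟩⟨2|, K₄ = √(1−p) |1⟩⟨2|, i.e. 𝓔^□(ρ) = Σ_{i=1}^4 K_i ρ K_i†. Let ρ₀^□ = p|0⟩⟨0| + (1−p)|1⟩⟨1| and ρ₁^□ = |2⟩⟨2|. Then: (i) 𝓔^□(ρ₀^□) = ρ₁^□ and 𝓔^□(ρ₁^□) = ρ₀^□; (ii) 𝓔^□ is ergodic with unique fixed-point state ρ*^□ = (ρ₀^□ + ρ₁^□)/2; (iii) ϑ^□ = ρ₀^□ − ρ₁^□ satisfies 𝓔^□(ϑ^□)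 = −ϑ^□, so the peripheral spectrum is {1, −1} and 𝓔^□ is not mixing. -/
open Matrix Kronecker
open scoped ComplexOrder
noncomputable section

/-- A channel is mixing when it is ergodic and its space of recurrences is
one-dimensional. -/
def IsMixing {n : ℕ} (E : MatC n →ₗ[ℂ] MatC n) : Prop :=
  IsErgodic E ∧ Module.finrank ℂ (recSpace E) = 1

/-- The qutrit channel `𝓔^□(ρ) = Σᵢ Kᵢ ρ Kᵢ†` with Kraus operators `K₁ = |2⟩⟨0|`,
`K₂ = |2⟩⟨1|`, `K₃ = √p |0⟩⟨2|`, `K₄ = √(1−p) |1⟩⟨2|`. -/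
def Esq (p : ℝ) : MatC 3 →ₗ[ℂ] MatC 3 :=
  conjMap (Matrix.single 2 0 1) (Matrix.single 0 2 1)
    + conjMap (Matrix.single 2 1 1) (Matrix.single 1 2 1)
    + conjMap ((Real.sqrt p : ℂ) • Matrix.single 0 2 1)
        ((Real.sqrt p : ℂ) • Matrix.single 2 0 1)
    + conjMap ((Real.sqrt (1 - p) : ℂ) • Matrix.single 1 2 1)
        ((Real.sqrt (1 - p) : ℂ) • Matrix.single 2 1 1)

/-- The state `ρ₀^□ = p|0⟩⟨0| + (1−p)|1⟩⟨1|`. -/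
def rho0sq (p : ℝ) : MatC 3 :=
  (p : ℂ) • Matrix.single 0 0 1 + ((1 - p : ℝ) : ℂ) • Matrix.single 1 1 1

/-- The state `ρ₁^□ = |2⟩⟨2|`. -/
def rho1sq : MatC 3 := Matrix.single 2 2 1

theorem Esq_apply (p : ℝ) (hp0 : 0 < p) (hp1 : p < 1) (X : MatC 3) :
    Esq p X = (X 0 0 + X 1 1) • rho1sq + X 2 2 • rho0sq p := by
  have h1 : (Real.sqrt p : ℂ) * (Real.sqrt p : ℂ) = (p : ℂ) := by
    rw [← Complex.ofReal_mul, Real.mul_self_sqrt hp0.le]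
  have h2 : (Real.sqrt (1 - p) : ℂ) * (Real.sqrt (1 - p) : ℂ) = ((1 - p : ℝ) : ℂ) := by
    rw [← Complex.ofReal_mul, Real.mul_self_sqrt (by linarith)]
  have h : Esq p X = Matrix.single 2 0 1 * X * Matrix.single 0 2 1
      + Matrix.single 2 1 1 * X * Matrix.single 1 2 1
      + ((Real.sqrt p : ℂ) * (Real.sqrt p : ℂ)) •
        (Matrix.single 0 2 1 * X * Matrix.single 2 0 1)
      + ((Real.sqrt (1 - p) : ℂ) * (Real.sqrt (1 - p) : ℂ)) •
        (Matrix.single 1 2 1 * X * Matrix.single 2 1 1) := by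
    simp [Esq, conjMap]
    rw [mul_right_comm, mul_right_comm (Real.sqrt (1 - p) : ℂ)]
  rw [h, h1, h2]
  ext i j
  fin_cases i <;> fin_cases j <;>
    simp [rho0sq, rho1sq, Matrix.mul_apply, Fin.sum_univ_three, Matrix.single_apply, mul_comm]

theorem rho0sq_00 (p : ℝ) : rho0sq p 0 0 = p := by simp [rho0sq, Matrix.single_apply]
theorem rho0sq_11 (p : ℝ) : rho0sq p 1 1 = 1 - p := by simp [rho0sq, Matrix.single_apply]
theorem rho0sq_22 (p : ℝ) : rho0sq p 2 2 = 0 := by simp [rho0sq, Matrix.single_apply]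
theorem rho1sq_00 : rho1sq 0 0 = 0 := by simp [rho1sq, Matrix.single_apply]
theorem rho1sq_11 : rho1sq 1 1 = 0 := by simp [rho1sq, Matrix.single_apply]
theorem rho1sq_22 : rho1sq 2 2 = 1 := by simp [rho1sq, Matrix.single_apply]

/-- **The qutrit channel `𝓔^□` is ergodic but not mixing.**
For `p ∈ (0,1)`: (i) `𝓔^□` swaps `ρ₀^□` and `ρ₁^□`; (ii) it is ergodic with unique
fixed-point state `ρ*^□ = (ρ₀^□ + ρ₁^□)/2`; (iii) `ϑ^□ = ρ₀^□ − ρ₁^□` is a peripheral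
eigenoperator with eigenvalue `−1`, the peripheral spectrum is `{1, −1}`, and `𝓔^□` is
not mixing. -/
theorem esq_ergodic_not_mixing (p : ℝ) (hp0 : 0 < p) (hp1 : p < 1) :
    (Esq p (rho0sq p) = rho1sq ∧ Esq p rho1sq = rho0sq p) ∧
    (IsErgodic (Esq p) ∧
      Esq p ((2⁻¹ : ℂ) • (rho0sq p + rho1sq)) = (2⁻¹ : ℂ) • (rho0sq p + rho1sq) ∧
      ∀ σ : MatC 3, σ.PosSemidef → σ.trace = 1 → Esq p σ = σ →
        σ = (2⁻¹ : ℂ) • (rho0sq p + rho1sq)) ∧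
    (Esq p (rho0sq p - rho1sq) = -(rho0sq p - rho1sq) ∧
      {μ : ℂ | Module.End.HasEigenvalue (Esq p) μ ∧ ‖μ‖ = 1} = {1, -1} ∧
      ¬ IsMixing (Esq p)) := by
  have hE := Esq_apply p hp0 hp1
  have e0 : Esq p (rho0sq p) = rho1sq := by
    rw [hE, rho0sq_00, rho0sq_11, rho0sq_22]; simp
  have e1 : Esq p rho1sq = rho0sq p := by
    rw [hE, rho1sq_00, rho1sq_11, rho1sq_22]; simp
  have eplus : Esq p (rho0sq p + rho1sq) = rho0sq p + rho1sq := by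
    rw [map_add, e0, e1, add_comm]
  have eminus : Esq p (rho0sq p - rho1sq) = -(rho0sq p - rho1sq) := by
    rw [map_sub, e0, e1, neg_sub]
  have nplus : rho0sq p + rho1sq ≠ 0 := fun h => by
    have := congrFun (congrFun h 2) 2
    simp [rho0sq_22, rho1sq_22] at this
  have nminus : rho0sq p - rho1sq ≠ 0 := fun h => by
    have := congrFun (congrFun h 2) 2
    simp [rho0sq_22, rho1sq_22] at this
  -- diagonal consequences of an eigenvalue equation
  have heig : ∀ (μ : ℂ) (X : MatC 3), Esq p X = μ • X →
      X 2 2 = μ * (X 0 0 + X 1 1) ∧ X 0 0 + X 1 1 = μ * X 2 2 := by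
    intro μ X h
    rw [hE] at h
    have a0 := congrFun (congrFun h 0) 0
    have a1 := congrFun (congrFun h 1) 1
    have a2 := congrFun (congrFun h 2) 2
    simp only [Matrix.add_apply, Matrix.smul_apply, smul_eq_mul, rho0sq_00, rho0sq_11,
      rho0sq_22, rho1sq_00, rho1sq_11, rho1sq_22] at a0 a1 a2
    constructor
    · linear_combination a0 + a1
    · linear_combination a2
  have hfix : ∀ X : MatC 3, Esq p X = X → X = X 2 2 • (rho0sq p + rho1sq) := by
    intro X h
    have h2 := (heig 1 X (by rw [h, one_smul])).2
    rw [one_mul] at h2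
    have h3 := hE X
    rw [h, h2] at h3
    rw [smul_add, add_comm]
    exact h3
  have herg : IsErgodic (Esq p) := by
    unfold IsErgodic
    refine finrank_eq_one (⟨rho0sq p + rho1sq, ?_⟩ : Module.End.eigenspace (Esq p) 1) ?_ ?_
    · rw [Module.End.mem_eigenspace_iff, eplus, one_smul]
    · intro h
      exact nplus (congrArg Subtype.val h)
    · rintro ⟨X, hX⟩
      rw [Module.End.mem_eigenspace_iff, one_smul] at hX
      exact ⟨X 2 2, Subtype.ext (hfix X hX).symm⟩
  refine ⟨⟨e0, e1⟩, ⟨herg, ?_, ?_⟩, eminus, ?_, ?_⟩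
  · rw [map_smul, eplus]
  · intro σ _ htr h
    have h2 := (heig 1 σ (by rw [h, one_smul])).2
    rw [Matrix.trace_fin_three] at htr
    have h3 : σ 2 2 = 2⁻¹ := by linear_combination (1 / 2) * htr - (1 / 2) * h2
    have := hfix σ h
    rwa [h3] at this
  · ext μ
    simp only [Set.mem_setOf_eq, Set.mem_insert_iff, Set.mem_singleton_iff]
    constructor
    · rintro ⟨hμ, hn⟩
      obtain ⟨X, hX, hX0⟩ := hμ.exists_hasEigenvector
      rw [Module.End.mem_eigenspace_iff] at hX
      obtain ⟨h1, h2⟩ := heig μ X hX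
      have hb : (μ * μ - 1) * X 2 2 = 0 := by linear_combination -h1 - μ * h2
      rcases mul_eq_zero.1 hb with h | h
      · exact mul_self_eq_one_iff.1 (sub_eq_zero.1 h)
      · exfalso
        have h3 := hE X
        rw [h2, h, hX] at h3
        simp only [mul_zero, zero_smul, add_zero] at h3
        rcases smul_eq_zero.1 h3 with h | h
        · simp [h] at hn
        · exact hX0 h
    · rintro (rfl | rfl)
      · refine ⟨Module.End.hasEigenvalue_of_hasEigenvector (x := rho0sq p + rho1sq)
          ⟨?_, nplus⟩, by simp⟩
        rw [Module.End.mem_eigenspace_iff, eplus, one_smul]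
      · refine ⟨Module.End.hasEigenvalue_of_hasEigenvector (x := rho0sq p - rho1sq)
          ⟨?_, nminus⟩, by simp⟩
        rw [Module.End.mem_eigenspace_iff, eminus, neg_smul, one_smul]
  · rintro ⟨_, hrec⟩
    have le : ∀ μ : ℂ, ‖μ‖ = 1 → Module.End.eigenspace (Esq p) μ ≤ recSpace (Esq p) :=
      fun μ hμ => le_iSup₂_of_le (f := fun (μ : ℂ) (_ : μ ∈ {μ : ℂ | ‖μ‖ = 1}) =>
        Module.End.eigenspace (Esq p) μ) μ hμ le_rfl
    have heq := Submodule.eq_of_le_of_finrank_eq (le 1 (by simp))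
      ((show Module.finrank ℂ (Module.End.eigenspace (Esq p) 1) = 1 from herg).trans hrec.symm)
    have hm : rho0sq p - rho1sq ∈ recSpace (Esq p) := by
      refine le (-1) (by simp) ?_
      rw [Module.End.mem_eigenspace_iff, eminus, neg_smul, one_smul]
    rw [← heq, Module.End.mem_eigenspace_iff, eminus, one_smul] at hm
    have := congrFun (congrFun hm 2) 2
    simp only [Matrix.neg_apply, Matrix.sub_apply, rho0sq_22, rho1sq_22] at this
    norm_num at this
end
end

section
/- Let 𝓔^Ł : B(ℂ³) → B(ℂ³) be the qutrit channel 𝓔^Ł(ρ) = |0⟩⟨1|ρ|1⟩⟨0| + |1⟩⟨0|ρ|0⟩⟨1| + |0⟩⟨2|ρ|2⟩⟨0|. Then: (i) 𝓔^Ł is ergodic with unique fixed-point state ρ*^Ł = (|0⟩⟨0| + |1⟩⟨1|)/2, i.e. F(𝓔^Ł) = {a ρ*^Ł : a ∈ ℂ}; (ii) the operator ϑ^Ł = |0⟩⟨0| − |1⟩⟨1| satisfies 𝓔^Ł(ϑ^Ł) = −ϑ^Ł, so the peripheral spectrum is σ_φ(𝓔^Ł) = {1, −1} and 𝓔^Ł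 is not mixing; and (iii) 𝓔^Ł is not irreducible, since its unique fixed-point state ρ*^Ł is not of full rank. -/
open Matrix Kronecker
open scoped ComplexOrder
noncomputable section

/-- A channel is irreducible when it is ergodic and its unique fixed-point state has
full rank (is positive definite). -/
def ChannelIrreducible {n : ℕ} (E : MatC n →ₗ[ℂ] MatC n) : Prop :=
  IsErgodic E ∧ ∀ ρ : MatC n, ρ.PosSemidef → ρ.trace = 1 → E ρ = ρ → ρ.PosDef

/-- The qutrit channel `𝓔^Ł(ρ) = |0⟩⟨1|ρ|1⟩⟨0| + |1⟩⟨0|ρ|0⟩⟨1| + |0⟩⟨2|ρ|2⟩⟨0|`. -/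
def ELsh : MatC 3 →ₗ[ℂ] MatC 3 :=
  conjMap (Matrix.single 0 1 1) (Matrix.single 1 0 1)
    + conjMap (Matrix.single 1 0 1) (Matrix.single 0 1 1)
    + conjMap (Matrix.single 0 2 1) (Matrix.single 2 0 1)

/-- The state `ρ*^Ł = (|0⟩⟨0| + |1⟩⟨1|)/2`. -/
def rhoLsh : MatC 3 :=
  (2⁻¹ : ℂ) • (Matrix.single 0 0 1 + Matrix.single 1 1 1)

theorem ELsh_apply (X : MatC 3) :
    ELsh X = !![X 1 1 + X 2 2, 0, 0; 0, X 0 0, 0; 0, 0, 0] := by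
  ext i j
  fin_cases i <;> fin_cases j <;>
    simp [ELsh, conjMap, Matrix.mul_apply, Fin.sum_univ_three, Matrix.single_apply]

theorem rhoLsh_eq : rhoLsh = !![2⁻¹, 0, 0; 0, 2⁻¹, 0; 0, 0, 0] := by
  ext i j
  fin_cases i <;> fin_cases j <;> simp [rhoLsh, Matrix.single_apply]

theorem theta_eq : (Matrix.single 0 0 1 - Matrix.single 1 1 1 : MatC 3)
    = !![1, 0, 0; 0, -1, 0; 0, 0, 0] := by
  ext i j
  fin_cases i <;> fin_cases j <;> simp [Matrix.single_apply]

theorem ELsh_rho : ELsh rhoLsh = rhoLsh := by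
  rw [ELsh_apply, rhoLsh_eq]
  simp

theorem ELsh_theta : ELsh (Matrix.single 0 0 1 - Matrix.single 1 1 1)
    = -(Matrix.single 0 0 1 - Matrix.single 1 1 1) := by
  rw [ELsh_apply, theta_eq]
  ext i j
  fin_cases i <;> fin_cases j <;> simp

theorem rhoLsh_ne : rhoLsh ≠ 0 := by
  intro h
  have := congrFun (congrFun h 0) 0
  rw [rhoLsh_eq] at this
  simp at this

theorem theta_ne : (Matrix.single 0 0 1 - Matrix.single 1 1 1 : MatC 3) ≠ 0 := by
  intro h
  have := congrFun (congrFun h 0) 0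
  rw [theta_eq] at this
  simp at this

theorem ELsh_eigenspace : Module.End.eigenspace ELsh 1 = Submodule.span ℂ {rhoLsh} := by
  ext X
  rw [Module.End.mem_eigenspace_iff, Submodule.mem_span_singleton, one_smul]
  constructor
  · intro h
    have e : ∀ i j, ELsh X i j = X i j := fun i j => by rw [h]
    rw [ELsh_apply] at e
    have h11 := e 1 1
    simp at h11
    refine ⟨2 * X 0 0, ?_⟩
    rw [rhoLsh_eq]
    ext i j
    have := e i j
    fin_cases i <;> fin_cases j <;> simp at this ⊢ <;> first | exact this | (rw [← this]; ring) | ring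
  · rintro ⟨a, rfl⟩
    rw [map_smul, ELsh_rho]

theorem ELsh_ergodic : IsErgodic ELsh := by
  rw [IsErgodic, ELsh_eigenspace]
  exact finrank_span_singleton rhoLsh_ne

theorem rhoLsh_rank : Matrix.rank rhoLsh < 3 := by
  by_contra hlt
  have hle := Matrix.rank_le_card_width rhoLsh
  have h3 : rhoLsh.rank = 3 := by simp at hle; omega
  have hli : LinearIndependent ℂ rhoLsh.row := by
    rw [linearIndependent_iff_card_eq_finrank_span, Set.finrank, ← Matrix.rank_eq_finrank_span_row, h3]
    simp
  apply hli.ne_zero 2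
  ext j
  rw [rhoLsh_eq]
  fin_cases j <;> simp [Matrix.row]

theorem rhoLsh_psd : rhoLsh.PosSemidef := by
  have : rhoLsh = Matrix.diagonal ![2⁻¹, 2⁻¹, 0] := by
    rw [rhoLsh_eq]
    ext i j
    fin_cases i <;> fin_cases j <;> simp
  rw [this]
  apply Matrix.PosSemidef.diagonal
  intro i
  fin_cases i <;> simp

theorem ELsh_peripheral :
    {μ : ℂ | Module.End.HasEigenvalue ELsh μ ∧ ‖μ‖ = 1} = {1, -1} := by
  ext μ
  simp only [Set.mem_setOf_eq, Set.mem_insert_iff, Set.mem_singleton_iff]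
  constructor
  · rintro ⟨h, hn⟩
    have hμ : μ ≠ 0 := by
      rintro rfl
      simp at hn
    obtain ⟨X, hX, hX0⟩ := h.exists_hasEigenvector
    rw [Module.End.mem_eigenspace_iff] at hX
    have e : ∀ i j, ELsh X i j = μ * X i j := fun i j => by rw [hX]; rfl
    rw [ELsh_apply] at e
    have h00 := e 0 0
    have h11 := e 1 1
    have h22 := e 2 2
    simp [hμ] at h00 h11 h22
    rw [h22, add_zero] at h00
    have hsq : (μ ^ 2 - 1) * X 1 1 = 0 := by
      linear_combination (-1 : ℂ) * h00 - μ * h11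
    rcases mul_eq_zero.1 hsq with h | h
    · exact (sq_eq_sq_iff_eq_or_eq_neg.1 (by linear_combination h : μ ^ 2 = 1 ^ 2))
    · exfalso
      apply hX0
      rw [h, mul_zero] at h11
      ext i j
      have := e i j
      fin_cases i <;> fin_cases j <;> simp_all
  · rintro (rfl | rfl)
    · exact ⟨Module.End.hasEigenvalue_of_hasEigenvector (x := rhoLsh)
        ⟨by rw [Module.End.mem_eigenspace_iff, one_smul, ELsh_rho], rhoLsh_ne⟩, by simp⟩
    · exact ⟨Module.End.hasEigenvalue_of_hasEigenvector
        ⟨by rw [Module.End.mem_eigenspace_iff, ELsh_theta, neg_one_smul], theta_ne⟩, by simp⟩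

theorem ELsh_not_mixing : ¬ IsMixing ELsh := by
  rintro ⟨-, h⟩
  have mem : ∀ (μ : ℂ) (X : MatC 3), ‖μ‖ = 1 → ELsh X = μ • X → X ∈ recSpace ELsh := by
    intro μ X hμ hX
    have hle : Module.End.eigenspace ELsh μ ≤ recSpace ELsh :=
      le_iSup₂_of_le (f := fun (μ : ℂ) (_ : μ ∈ {μ : ℂ | ‖μ‖ = 1}) =>
        Module.End.eigenspace ELsh μ) μ hμ le_rfl
    exact hle (Module.End.mem_eigenspace_iff.2 hX)
  have hr := mem 1 rhoLsh (by simp) (by rw [ELsh_rho, one_smul])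
  have ht := mem (-1) _ (by simp) (by rw [ELsh_theta, neg_one_smul])
  obtain ⟨c, hc⟩ := (finrank_eq_one_iff_of_nonzero' (⟨rhoLsh, hr⟩ : recSpace ELsh)
    (by simpa using rhoLsh_ne)).1 h ⟨_, ht⟩
  have hc' : c • rhoLsh = (Matrix.single 0 0 1 - Matrix.single 1 1 1 : MatC 3) :=
    congrArg Subtype.val hc
  rw [rhoLsh_eq, theta_eq] at hc'
  have h0 := congrFun (congrFun hc' 0) 0
  have h1 := congrFun (congrFun hc' 1) 1
  simp at h0 h1
  rw [h0] at h1
  norm_num at h1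

theorem ELsh_not_irreducible : ¬ ChannelIrreducible ELsh := by
  rintro ⟨-, h⟩
  have hp := h rhoLsh rhoLsh_psd
    (by rw [rhoLsh_eq]; simp [Matrix.trace, Fin.sum_univ_three]; norm_num) ELsh_rho
  have := Matrix.rank_of_isUnit _ hp.isUnit
  have h3 := rhoLsh_rank
  simp at this
  omega

/-- **The qutrit channel `𝓔^Ł` is ergodic but neither mixing nor irreducible.**
(i) `𝓔^Ł` is ergodic with unique fixed-point state `ρ*^Ł = (|0⟩⟨0|+|1⟩⟨1|)/2` and
fixed-point space `{a ρ*^Ł : a ∈ ℂ}`; (ii) `ϑ^Ł = |0⟩⟨0| − |1⟩⟨1|` is a peripheral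
eigenoperator with eigenvalue `−1`, the peripheral spectrum is `{1, −1}`, and `𝓔^Ł` is
not mixing; (iii) `𝓔^Ł` is not irreducible, since its unique fixed-point state `ρ*^Ł`
is not of full rank. -/
theorem elsh_ergodic_not_irreducible :
    (IsErgodic ELsh ∧
      Module.End.eigenspace ELsh 1 = Submodule.span ℂ {rhoLsh} ∧
      ELsh rhoLsh = rhoLsh) ∧
    (ELsh (Matrix.single 0 0 1 - Matrix.single 1 1 1)
        = -(Matrix.single 0 0 1 - Matrix.single 1 1 1) ∧
      {μ : ℂ | Module.End.HasEigenvalue ELsh μ ∧ ‖μ‖ = 1} = {1, -1} ∧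
      ¬ IsMixing ELsh) ∧
    (¬ ChannelIrreducible ELsh ∧ Matrix.rank rhoLsh < 3) := by
  exact ⟨⟨ELsh_ergodic, ELsh_eigenspace, ELsh_rho⟩,
    ⟨ELsh_theta, ELsh_peripheral, ELsh_not_mixing⟩, ELsh_not_irreducible, rhoLsh_rank⟩
end
end
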